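/- arXiv:2010.10765 — 3 statements merged into one kernel-verified Lean document; each statement's English description precedes it below -/
import Mathlib

section
/- Let Λ be a left and right noetherian ring, let m, n ∈ ℕ ∪ {∞}, and let M be a finitely generated right Λ-module. Then M is (m,n)-torsionfree if and only if there exists an exact sequence σ : G_{m+1} → G_m → ⋯ → G₀ →∂ G_{-1} → ⋯ → G_{-n} of finitely generated Λ-modules such that every G_i (−n ≤ i ≤ m+1) is (m,n)-torsionfree, the image of ∂ is isomorphic to M, and the Λ-dual sequence σ* is also exact. -/
/-!
Formalization of a statement from:
T. Araya and R. Takahashi, "On reducing homological dimensions over noetherian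
rings" (arXiv:2010.10765).
-/

open Function Filter CategoryTheory

universe u

/-- A resolution of `M` by finitely generated free `A`-modules:
`⋯ → A^{rank 2} → A^{rank 1} → A^{rank 0} → M → 0`. -/
structure FreeResolution (A : Type u) [Ring A] (M : Type u) [AddCommGroup M]
    [Module A M] where
  rank : ℕ → ℕ
  d : ∀ i : ℕ, ((Fin (rank (i + 1)) → A) →ₗ[A] (Fin (rank i) → A))
  aug : (Fin (rank 0) → A) →ₗ[A] M
  aug_surjective : Function.Surjective aug
  exact_aug : Function.Exact (d 0) aug
  exact : ∀ i : ℕ, Function.Exact (d (i + 1)) (d i)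

/-- `ExtVanish A M N j` says that `Ext_A^{j+1}(M, N) = 0`: for every resolution `F`
of `M` by finitely generated free modules, the complex `Hom_A(F, N)` is exact at
homological position `j + 1`. -/
def ExtVanish (A : Type u) [Ring A] (M : Type u) [AddCommGroup M] [Module A M]
    (N : Type u) [AddCommGroup N] [Module A N] (j : ℕ) : Prop :=
  ∀ F : FreeResolution A M,
    Function.Exact
      (fun φ : (Fin (F.rank j) → A) →ₗ[A] N => φ.comp (F.d j))
      (fun φ : (Fin (F.rank (j + 1)) → A) →ₗ[A] N => φ.comp (F.d (j + 1)))

/-- `extNonzero A M N i` says that `Ext_A^i(M, N) ≠ 0`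
(for `i = 0` this reads `Hom_A(M, N) ≠ 0`). -/
def extNonzero (A : Type u) [Ring A] (M : Type u) [AddCommGroup M] [Module A M]
    (N : Type u) [AddCommGroup N] [Module A N] : ℕ → Prop
  | 0 => ∃ φ : M →ₗ[A] N, φ ≠ 0
  | (j + 1) => ¬ ExtVanish A M N j

/-- The `A`-dual `Hom_A(-, A)`, as an `Aᵐᵒᵖ`-linear map between dual modules. -/
def dualMap {A : Type u} [Ring A] {M N : Type u} [AddCommGroup M] [Module A M]
    [AddCommGroup N] [Module A N] (f : M →ₗ[A] N) :
    (N →ₗ[A] A) →ₗ[Aᵐᵒᵖ] (M →ₗ[A] A) where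
  toFun φ := φ.comp f
  map_add' _ _ := rfl
  map_smul' _ _ := rfl

/-- The (Auslander) transpose of `M` computed from the finite free presentation
`A^{rank 1} → A^{rank 0} → M → 0` contained in the resolution `F`, that is, the
cokernel of `Hom_A(A^{rank 0}, A) → Hom_A(A^{rank 1}, A)`; it is an `Aᵐᵒᵖ`-module
(i.e. a module on the other side), well defined up to projective summands. -/
abbrev FreeResolution.transpose {A : Type u} [Ring A] {M : Type u} [AddCommGroup M]
    [Module A M] (F : FreeResolution A M) : Type u :=
  ((Fin (F.rank 1) → A) →ₗ[A] A) ⧸ LinearMap.range (dualMap (F.d 0))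

/-- `M` is `(m,n)`-torsionfree: `Ext_A^i(M, A) = 0` for all `1 ≤ i ≤ m` and
`Ext_{Aᵒᵖ}^j(tr M, A) = 0` for all `1 ≤ j ≤ n` (read as "for all `i ≥ 1`", resp.
"for all `j ≥ 1`", when `m = ∞`, resp. `n = ∞`). -/
def IsMNTorsionFree (A : Type u) [Ring A] (M : Type u) [AddCommGroup M] [Module A M]
    (m n : ℕ∞) : Prop :=
  (∀ j : ℕ, (j : ℕ∞) + 1 ≤ m → ExtVanish A M A j) ∧
  (∀ F : FreeResolution A M, ∀ j : ℕ, (j : ℕ∞) + 1 ≤ n →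
    ExtVanish Aᵐᵒᵖ F.transpose A j)

/-- `M` is totally reflexive (= Gorenstein projective), i.e. `(∞,∞)`-torsionfree:
`Ext_A^i(M, A) = 0 = Ext_{Aᵒᵖ}^i(tr M, A)` for all `i ≥ 1`. -/
def IsTotallyReflexive (A : Type u) [Ring A] (M : Type u) [AddCommGroup M]
    [Module A M] : Prop :=
  IsMNTorsionFree A M ⊤ ⊤

/-- A `ℤ`-indexed sequence of `A`-modules `⋯ → P_{i+1} → P_i → P_{i-1} → ⋯`. -/
structure ZSeq (A : Type u) [Ring A] where
  P : ℤ → Type u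
  [acg : ∀ i, AddCommGroup (P i)]
  [mod : ∀ i, Module A (P i)]
  d : ∀ i : ℤ, P (i + 1) →ₗ[A] P i

attribute [instance] ZSeq.acg ZSeq.mod

/-- For `m, n ∈ ℕ ∪ {∞}`, the position `i : ℤ` lies in the range `-n ≤ i ≤ m + 1`
of the indices of the modules of a sequence `P_{m+1} → ⋯ → P_0 → P_{-1} → ⋯ → P_{-n}`. -/
def posIn (m n : ℕ∞) (i : ℤ) : Prop :=
  (0 ≤ i → (i.toNat : ℕ∞) ≤ m + 1) ∧ (i < 0 → ((-i).toNat : ℕ∞) ≤ n)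

/-- For `m, n ∈ ℕ ∪ {∞}`, the position `i : ℤ` lies in the range `-n + 1 ≤ i ≤ m`
of the interior nodes of a sequence `P_{m+1} → ⋯ → P_0 → P_{-1} → ⋯ → P_{-n}`
(the nodes at which exactness of the sequence makes sense). -/
def nodeIn (m n : ℕ∞) (i : ℤ) : Prop :=
  (0 < i → (i.toNat : ℕ∞) ≤ m) ∧ (i ≤ 0 → ((1 - i).toNat : ℕ∞) ≤ n)

open CategoryTheory.Abelian

section Ext

variable {A : Type u} [Ring A] {K P M : Type u} [AddCommGroup K] [Module A K]
  [AddCommGroup P] [Module A P] [AddCommGroup M] [Module A M]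

/-- `Ext_A^{j+1}(M, N) = 0`, in terms of Mathlib's `Ext` in the category of modules. -/
def ExtSubsingleton (A : Type u) [Ring A] (M : Type u) [AddCommGroup M] [Module A M]
    (N : Type u) [AddCommGroup N] [Module A N] (j : ℕ) : Prop :=
  Subsingleton (Ext (ModuleCat.of A M) (ModuleCat.of A N) (j + 1))

/-- `K → P → M` is a short exact sequence of modules. -/
structure IsShortExact (f : K →ₗ[A] P) (g : P →ₗ[A] M) : Prop where
  injective : Injective f
  surjective : Surjective g
  exact : Exact f g

variable {f : K →ₗ[A] P} {g : P →ₗ[A] M}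

/-- The short complex in the category of modules given by a short exact sequence. -/
abbrev IsShortExact.shortComplex (h : IsShortExact f g) : ShortComplex (ModuleCat.{u} A) :=
  ModuleCat.shortComplexOfCompEqZero f g h.exact.linearMap_comp_eq_zero

theorem IsShortExact.shortExact (h : IsShortExact f g) : h.shortComplex.ShortExact where
  exact := (ShortComplex.ShortExact.moduleCat_exact_iff_function_exact _).mpr h.exact
  mono_f := (ModuleCat.mono_iff_injective _).mpr h.injective
  epi_g := (ModuleCat.epi_iff_surjective _).mpr h.surjective

theorem isShortExact_subtype_ker (hg : Surjective g) : IsShortExact g.ker.subtype g :=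
  ⟨g.ker.injective_subtype, hg, g.exact_subtype_ker_map⟩

theorem extSubsingleton_of_projective [Module.Projective A P] (N : Type u) [AddCommGroup N]
    [Module A N] (j : ℕ) : ExtSubsingleton A P N j :=
  have : Projective (ModuleCat.of A P) := inferInstance
  Ext.subsingleton_of_projective _ _ _

variable {N : Type u} [AddCommGroup N] [Module A N]

theorem IsShortExact.extSubsingleton_succ (h : IsShortExact f g) {j : ℕ}
    (hP : ExtSubsingleton A P N (j + 1)) (hK : ExtSubsingleton A K N j) :
    ExtSubsingleton A M N (j + 1) := by
  refine subsingleton_of_forall_eq 0 fun x => ?_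
  obtain ⟨y, hy⟩ := Ext.contravariant_sequence_exact₃ h.shortExact (ModuleCat.of A N) x
    (hP.elim _ _) (n₀ := j + 1) (by omega)
  rw [← hy, show y = 0 from hK.elim _ _, Ext.comp_zero]

theorem IsShortExact.extSubsingleton_of_succ (h : IsShortExact f g) {j : ℕ}
    (hP : ExtSubsingleton A P N j) (hM : ExtSubsingleton A M N (j + 1)) :
    ExtSubsingleton A K N j := by
  refine subsingleton_of_forall_eq 0 fun x => ?_
  obtain ⟨y, hy⟩ := Ext.contravariant_sequence_exact₁ h.shortExact (ModuleCat.of A N) x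
    (n₁ := j + 2) (by omega) (hM.elim _ _)
  rw [← hy, show y = 0 from hP.elim _ _, Ext.comp_zero]

theorem IsShortExact.extSubsingleton_zero (h : IsShortExact f g)
    (hP : ExtSubsingleton A P N 0) (hext : ∀ φ : K →ₗ[A] N, ∃ ψ : P →ₗ[A] N, ψ ∘ₗ f = φ) :
    ExtSubsingleton A M N 0 := by
  refine subsingleton_of_forall_eq 0 fun x => ?_
  obtain ⟨y, hy⟩ := Ext.contravariant_sequence_exact₃ h.shortExact (ModuleCat.of A N) x
    (hP.elim _ _) (n₀ := 0) (by omega)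
  obtain ⟨φ, rfl⟩ := Ext.homEquiv₀.symm.surjective y
  obtain ⟨ψ, hψ⟩ := hext φ.hom
  have : φ = h.shortComplex.f ≫ ModuleCat.ofHom ψ := by
    ext1
    exact hψ.symm
  rw [← hy, this]
  simp only [Ext.homEquiv₀_symm_apply]
  rw [← Ext.mk₀_comp_mk₀, ShortComplex.ShortExact.extClass_comp_assoc]

theorem IsShortExact.exists_extension (h : IsShortExact f g) (hM : ExtSubsingleton A M N 0)
    (φ : K →ₗ[A] N) : ∃ ψ : P →ₗ[A] N, ψ ∘ₗ f = φ := by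
  obtain ⟨y, hy⟩ := Ext.contravariant_sequence_exact₁ h.shortExact (ModuleCat.of A N)
    (Ext.mk₀ (ModuleCat.ofHom φ)) (n₁ := 1) (by omega) (hM.elim _ _)
  obtain ⟨ψ, rfl⟩ := Ext.homEquiv₀.symm.surjective y
  refine ⟨ψ.hom, ?_⟩
  simp only [Ext.homEquiv₀_symm_apply] at hy
  rw [Ext.mk₀_comp_mk₀] at hy
  exact congrArg ModuleCat.Hom.hom ((Ext.mk₀_bijective _ _).1 hy)

theorem IsShortExact.extSubsingleton_succ_iff [Module.Projective A P] (h : IsShortExact f g)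
    {j : ℕ} : ExtSubsingleton A M N (j + 1) ↔ ExtSubsingleton A K N j :=
  ⟨h.extSubsingleton_of_succ (extSubsingleton_of_projective N j),
    h.extSubsingleton_succ (extSubsingleton_of_projective N (j + 1))⟩

theorem IsShortExact.extSubsingleton_zero_iff [Module.Projective A P] (h : IsShortExact f g) :
    ExtSubsingleton A M N 0 ↔ ∀ φ : K →ₗ[A] N, ∃ ψ : P →ₗ[A] N, ψ ∘ₗ f = φ :=
  ⟨h.exists_extension, h.extSubsingleton_zero (extSubsingleton_of_projective N 0)⟩

end Ext

section FreeResolution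

variable {A : Type u} [Ring A] {M : Type u} [AddCommGroup M] [Module A M]

/-- The resolution of the first syzygy obtained by forgetting the degree zero term. -/
def FreeResolution.syzygy (F : FreeResolution A M) : FreeResolution A F.aug.ker where
  rank i := F.rank (i + 1)
  d i := F.d (i + 1)
  aug := (F.d 0).codRestrict F.aug.ker fun x => F.exact_aug.apply_apply_eq_zero x
  aug_surjective := by
    rintro ⟨y, hy⟩
    obtain ⟨x, rfl⟩ := (F.exact_aug y).1 hy
    exact ⟨x, rfl⟩
  exact_aug x := by
    rw [← F.exact 0 x, Subtype.ext_iff]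
    rfl
  exact i := F.exact (i + 1)

/-- A map vanishing on the kernel of a surjection factors through it. -/
theorem LinearMap.exists_comp_eq_of_ker_le {P K N : Type*} [AddCommGroup P] [Module A P]
    [AddCommGroup K] [Module A K] [AddCommGroup N] [Module A N] {p : P →ₗ[A] K}
    (hp : Surjective p) (φ : P →ₗ[A] N) (h : p.ker ≤ φ.ker) : ∃ ψ : K →ₗ[A] N, ψ ∘ₗ p = φ := by
  refine ⟨p.ker.liftQ φ h ∘ₗ (p.quotKerEquivOfSurjective hp).symm.toLinearMap, ?_⟩
  ext x
  have : (p.quotKerEquivOfSurjective hp).symm (p x) = p.ker.mkQ x := by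
    rw [LinearEquiv.symm_apply_eq]
    rfl
  simp [this]

theorem FreeResolution.exact_hom_iff (F : FreeResolution A M) (N : Type u) [AddCommGroup N]
    [Module A N] (j : ℕ) :
    Exact (fun φ : (Fin (F.rank j) → A) →ₗ[A] N => φ.comp (F.d j))
      (fun φ : (Fin (F.rank (j + 1)) → A) →ₗ[A] N => φ.comp (F.d (j + 1))) ↔
    ExtSubsingleton A M N j := by
  induction j generalizing M with
  | zero =>
    rw [(isShortExact_subtype_ker F.aug_surjective).extSubsingleton_zero_iff]
    have hd : F.d 0 = F.aug.ker.subtype ∘ₗ F.syzygy.aug := rfl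
    constructor
    · intro h φ
      obtain ⟨ψ, hψ⟩ := (h (φ ∘ₗ F.syzygy.aug)).1 <| by
        refine LinearMap.ext fun x => ?_
        exact (congrArg φ (F.syzygy.exact_aug.apply_apply_eq_zero x)).trans (map_zero φ)
      refine ⟨ψ, ?_⟩
      rw [← LinearMap.cancel_right F.syzygy.aug_surjective, LinearMap.comp_assoc, ← hd]
      exact hψ
    · intro h φ
      constructor
      · intro hφ
        obtain ⟨φ', rfl⟩ := LinearMap.exists_comp_eq_of_ker_le F.syzygy.aug_surjective φ <| by
          intro x hx
          obtain ⟨y, rfl⟩ := (F.syzygy.exact_aug x).1 hx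
          exact LinearMap.congr_fun hφ y
        obtain ⟨ψ, rfl⟩ := h φ'
        exact ⟨ψ, rfl⟩
      · rintro ⟨ψ, rfl⟩
        refine LinearMap.ext fun x => ?_
        change ψ (F.d 0 (F.d 1 x)) = 0
        rw [(F.exact 0).apply_apply_eq_zero, map_zero]
  | succ j ih =>
    rw [(isShortExact_subtype_ker F.aug_surjective).extSubsingleton_succ_iff, ← ih F.syzygy]
    rfl

theorem exists_exact_fin [IsNoetherianRing A] {k : ℕ} (f : (Fin k → A) →ₗ[A] M) :
    ∃ (l : ℕ) (g : (Fin l → A) →ₗ[A] (Fin k → A)), Exact g f := by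
  obtain ⟨l, g, hg⟩ := Module.Finite.exists_fin' A f.ker
  refine ⟨l, f.ker.subtype ∘ₗ g, LinearMap.exact_iff.mpr ?_⟩
  rw [LinearMap.range_comp_of_range_eq_top _ (LinearMap.range_eq_top.mpr hg),
    Submodule.range_subtype]

theorem nonempty_freeResolution [IsNoetherianRing A] [Module.Finite A M] :
    Nonempty (FreeResolution A M) := by
  obtain ⟨k, p, hp⟩ := Module.Finite.exists_fin' A M
  obtain ⟨l, g, hg⟩ := exists_exact_fin p
  choose r q hq using fun f : (Σ k l : ℕ, (Fin l → A) →ₗ[A] (Fin k → A)) =>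
    exists_exact_fin f.2.2
  let s : ℕ → (Σ k l : ℕ, (Fin l → A) →ₗ[A] (Fin k → A)) := fun n =>
    n.rec ⟨k, l, g⟩ fun _ f => ⟨f.2.1, r f, q f⟩
  exact ⟨{
    rank := fun i => (s i).1
    d := fun i => (s i).2.2
    aug := p
    aug_surjective := hp
    exact_aug := hg
    exact := fun i => hq (s i) }⟩

theorem extVanish_iff [IsNoetherianRing A] [Module.Finite A M] (N : Type u) [AddCommGroup N]
    [Module A N] (j : ℕ) : ExtVanish A M N j ↔ ExtSubsingleton A M N j :=
  ⟨fun h => nonempty_freeResolution.elim fun F => (F.exact_hom_iff N j).1 (h F),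
    fun h F => (F.exact_hom_iff N j).2 h⟩

end FreeResolution

section Dual

open MulOpposite

variable {A : Type u} [Ring A] {M : Type u} [AddCommGroup M] [Module A M]

/-- The evaluation map from a module to its double dual. -/
def evalDual (A : Type u) [Ring A] (M : Type u) [AddCommGroup M] [Module A M] :
    M →ₗ[A] ((M →ₗ[A] A) →ₗ[Aᵐᵒᵖ] A) where
  toFun x :=
    { toFun := fun f => f x
      map_add' := fun _ _ => rfl
      map_smul' := fun _ _ => rfl }
  map_add' x y := LinearMap.ext fun f => f.map_add x y
  map_smul' a x := LinearMap.ext fun f => f.map_smul a x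

@[simp]
theorem evalDual_apply (x : M) (f : M →ₗ[A] A) : evalDual A M x f = f x := rfl

@[simp]
theorem dualMap_apply_apply {N : Type u} [AddCommGroup N] [Module A N] (f : M →ₗ[A] N)
    (φ : N →ₗ[A] A) (x : M) : dualMap f φ x = φ (f x) := rfl

theorem dualMap_injective {N : Type u} [AddCommGroup N] [Module A N] {f : M →ₗ[A] N}
    (hf : Surjective f) : Injective (dualMap f) := fun _ _ h =>
  (LinearMap.cancel_right hf).1 h

theorem dualMap_exact {K P : Type u} [AddCommGroup K] [Module A K] [AddCommGroup P] [Module A P]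
    {f : K →ₗ[A] P} {g : P →ₗ[A] M} (hg : Surjective g) (hfg : Exact f g) :
    Exact (dualMap g) (dualMap f) := by
  intro φ
  constructor
  · intro hφ
    obtain ⟨ψ, hψ⟩ := LinearMap.exists_comp_eq_of_ker_le hg φ <| by
      intro x hx
      obtain ⟨y, rfl⟩ := (hfg x).1 hx
      exact LinearMap.congr_fun hφ y
    exact ⟨ψ, hψ⟩
  · rintro ⟨ψ, rfl⟩
    refine LinearMap.ext fun x => ?_
    simp [hfg.apply_apply_eq_zero x]

section Free

variable [Module.Free A M]

theorem evalDual_injective_of_free : Injective (evalDual A M) := by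
  rw [injective_iff_map_eq_zero]
  intro x hx
  refine (Module.Free.chooseBasis A M).ext_elem fun i => ?_
  simpa using LinearMap.congr_fun hx ((Module.Free.chooseBasis A M).coord i)

variable [Module.Finite A M]

theorem evalDual_surjective_of_free : Surjective (evalDual A M) := by
  intro ψ
  let b := Module.Free.chooseBasis A M
  refine ⟨∑ i, ψ (b.coord i) • b i, LinearMap.ext fun f => ?_⟩
  have hf : f = ∑ i, op (f (b i)) • b.coord i := b.ext fun i => by
    classical simp [LinearMap.sum_apply, Finsupp.single_apply]
  conv_rhs => rw [hf]
  simp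

/-- The dual of a finite free module is isomorphic to a finite power of `A` on the other side. -/
noncomputable def dualEquivOfFree :
    (M →ₗ[A] A) ≃ₗ[Aᵐᵒᵖ] (Module.Free.ChooseBasisIndex A M → Aᵐᵒᵖ) :=
  ((Module.Free.chooseBasis A M).constr Aᵐᵒᵖ).symm.trans
    (LinearEquiv.piCongrRight fun _ => opLinearEquiv Aᵐᵒᵖ)

instance : Module.Free Aᵐᵒᵖ (M →ₗ[A] A) := Module.Free.of_equiv dualEquivOfFree.symm

instance : Module.Finite Aᵐᵒᵖ (M →ₗ[A] A) := Module.Finite.equiv dualEquivOfFree.symm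

end Free

theorem exists_eval_of_free_op {Q : Type u} [AddCommGroup Q] [Module Aᵐᵒᵖ Q]
    [Module.Free Aᵐᵒᵖ Q] [Module.Finite Aᵐᵒᵖ Q] (ψ : (Q →ₗ[Aᵐᵒᵖ] A) →ₗ[A] A) :
    ∃ q : Q, ∀ f, ψ f = f q := by
  let b := Module.Free.chooseBasis Aᵐᵒᵖ Q
  let c i : Q →ₗ[Aᵐᵒᵖ] A := (opLinearEquiv Aᵐᵒᵖ).symm.toLinearMap ∘ₗ b.coord i
  refine ⟨∑ i, op (ψ (c i)) • b i, fun f => ?_⟩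
  have hf : f = ∑ i, f (b i) • c i := b.ext fun i => by
    classical
    simp only [LinearMap.sum_apply, LinearMap.smul_apply]
    rw [Finset.sum_eq_single i] <;> simp +contextual [c]
  conv_lhs => rw [hf]
  simp

theorem eq_zero_of_free_op {Q : Type u} [AddCommGroup Q] [Module Aᵐᵒᵖ Q] [Module.Free Aᵐᵒᵖ Q]
    {q : Q} (hq : ∀ f : Q →ₗ[Aᵐᵒᵖ] A, f q = 0) : q = 0 := by
  let b := Module.Free.chooseBasis Aᵐᵒᵖ Q
  refine b.ext_elem fun i => ?_
  simpa using hq ((opLinearEquiv Aᵐᵒᵖ).symm.toLinearMap ∘ₗ b.coord i)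

theorem finite_dual [IsNoetherianRing Aᵐᵒᵖ] [Module.Finite A M] :
    Module.Finite Aᵐᵒᵖ (M →ₗ[A] A) := by
  obtain ⟨k, p, hp⟩ := Module.Finite.exists_fin' A M
  exact Module.Finite.of_injective (dualMap p) (dualMap_injective hp)

variable (F : FreeResolution A M)

theorem FreeResolution.isShortExact_dual :
    IsShortExact (M := (dualMap (F.d 0)).range) (dualMap F.aug)
      (dualMap (F.d 0)).rangeRestrict where
  injective := dualMap_injective F.aug_surjective
  surjective := (dualMap (F.d 0)).surjective_rangeRestrict
  exact φ := by
    rw [← dualMap_exact F.aug_surjective F.exact_aug φ, Subtype.ext_iff]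
    rfl

theorem FreeResolution.isShortExact_transpose :
    IsShortExact (K := (dualMap (F.d 0)).range) (M := F.transpose)
      (dualMap (F.d 0)).range.subtype (dualMap (F.d 0)).range.mkQ where
  injective := Submodule.injective_subtype _
  surjective := Submodule.mkQ_surjective _
  exact := LinearMap.exact_subtype_mkQ _

theorem FreeResolution.extSubsingleton_transpose_zero :
    ExtSubsingleton Aᵐᵒᵖ F.transpose A 0 ↔ Injective (evalDual A M) := by
  rw [F.isShortExact_transpose.extSubsingleton_zero_iff]
  constructor
  · rw [injective_iff_map_eq_zero]
    intro h x hx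
    obtain ⟨y, rfl⟩ := F.aug_surjective x
    obtain ⟨φ, hφ⟩ := LinearMap.exists_comp_eq_of_ker_le
        (K := (dualMap (F.d 0)).range) (LinearMap.surjective_rangeRestrict _) (evalDual A _ y) <| by
      intro g hg
      obtain ⟨f, rfl⟩ := (F.isShortExact_dual.exact g).1 hg
      exact LinearMap.congr_fun hx f
    obtain ⟨ψ, hψ⟩ := h φ
    obtain ⟨z, rfl⟩ := evalDual_surjective_of_free ψ
    refine (F.exact_aug y).2 ⟨z, evalDual_injective_of_free (A := A) (LinearMap.ext fun g => ?_)⟩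
    rw [← hφ, ← hψ]
    rfl
  · intro h φ
    obtain ⟨y, hy⟩ := evalDual_surjective_of_free (φ ∘ₗ (dualMap (F.d 0)).rangeRestrict)
    obtain ⟨z, rfl⟩ := (F.exact_aug y).1 <| (injective_iff_map_eq_zero _).1 h _ <|
      LinearMap.ext fun f => by
        refine (LinearMap.congr_fun hy (dualMap F.aug f)).trans ?_
        rw [LinearMap.comp_apply, F.isShortExact_dual.exact.apply_apply_eq_zero]
        simp
    refine ⟨evalDual A _ z, ?_⟩
    rw [← LinearMap.cancel_right F.isShortExact_dual.surjective, ← hy]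
    rfl

theorem FreeResolution.extSubsingleton_transpose_one :
    ExtSubsingleton Aᵐᵒᵖ F.transpose A 1 ↔ Surjective (evalDual A M) := by
  rw [F.isShortExact_transpose.extSubsingleton_succ_iff,
    F.isShortExact_dual.extSubsingleton_zero_iff]
  refine forall_congr' fun φ => ⟨?_, ?_⟩
  · rintro ⟨ψ, rfl⟩
    obtain ⟨y, rfl⟩ := evalDual_surjective_of_free ψ
    exact ⟨F.aug y, rfl⟩
  · rintro ⟨x, rfl⟩
    obtain ⟨y, rfl⟩ := F.aug_surjective x
    exact ⟨evalDual A _ y, rfl⟩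

theorem FreeResolution.extSubsingleton_transpose_add_two (j : ℕ) :
    ExtSubsingleton Aᵐᵒᵖ F.transpose A (j + 2) ↔ ExtSubsingleton Aᵐᵒᵖ (M →ₗ[A] A) A j := by
  rw [F.isShortExact_transpose.extSubsingleton_succ_iff,
    F.isShortExact_dual.extSubsingleton_succ_iff]

/-- A description of `n`-torsionfree modules through the double dual: the transpose does not
appear, so the condition does not refer to a presentation of the module. -/
structure IsTorsionFree (A : Type u) [Ring A] (M : Type u) [AddCommGroup M] [Module A M]
    (n : ℕ∞) : Prop where
  injective : 1 ≤ n → Injective (evalDual A M)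
  surjective : 2 ≤ n → Surjective (evalDual A M)
  ext : ∀ j : ℕ, (j : ℕ∞) + 3 ≤ n → ExtSubsingleton Aᵐᵒᵖ (M →ₗ[A] A) A j

theorem isTorsionFree_iff [IsNoetherianRing Aᵐᵒᵖ] (n : ℕ∞) : IsTorsionFree A M n ↔
    ∀ j : ℕ, (j : ℕ∞) + 1 ≤ n → ExtVanish Aᵐᵒᵖ F.transpose A j := by
  constructor
  · rintro h (_ | _ | j) hj
    · rw [extVanish_iff, F.extSubsingleton_transpose_zero]
      exact h.injective (by simpa using hj)
    · rw [extVanish_iff, F.extSubsingleton_transpose_one]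
      exact h.surjective (by simpa [one_add_one_eq_two] using hj)
    · rw [extVanish_iff, F.extSubsingleton_transpose_add_two]
      exact h.ext j (by exact_mod_cast hj)
  · refine fun h => ⟨fun hn => ?_, fun hn => ?_, fun j hn => ?_⟩
    · rw [← F.extSubsingleton_transpose_zero, ← extVanish_iff]
      exact h 0 (by simpa using hn)
    · rw [← F.extSubsingleton_transpose_one, ← extVanish_iff]
      exact h 1 (by simpa [one_add_one_eq_two] using hn)
    · rw [← F.extSubsingleton_transpose_add_two, ← extVanish_iff]
      exact h (j + 2) (by exact_mod_cast hn)

theorem isMNTorsionFree_iff [IsNoetherianRing A] [IsNoetherianRing Aᵐᵒᵖ] [Module.Finite A M]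
    (m n : ℕ∞) : IsMNTorsionFree A M m n ↔
      (∀ j : ℕ, (j : ℕ∞) + 1 ≤ m → ExtSubsingleton A M A j) ∧ IsTorsionFree A M n := by
  have := nonempty_freeResolution (A := A) (M := M)
  exact and_congr (forall₂_congr fun j _ => extVanish_iff A j) <|
    (forall_congr' fun F => (isTorsionFree_iff F n).symm).trans (forall_const _)

theorem isMNTorsionFree_of_free [IsNoetherianRing A] [IsNoetherianRing Aᵐᵒᵖ] [Module.Finite A M]
    [Module.Free A M] (m n : ℕ∞) : IsMNTorsionFree A M m n :=
  (isMNTorsionFree_iff m n).2 ⟨fun j _ => extSubsingleton_of_projective A j,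
    fun _ => evalDual_injective_of_free, fun _ => evalDual_surjective_of_free,
    fun j _ => extSubsingleton_of_projective A j⟩

end Dual

section Sequence

variable {A : Type u} [Ring A]

theorem IsTorsionFree.mono {M : Type u} [AddCommGroup M] [Module A M] {k n : ℕ∞}
    (h : IsTorsionFree A M n) (hk : k ≤ n) : IsTorsionFree A M k :=
  ⟨fun h1 => h.injective (h1.trans hk), fun h2 => h.surjective (h2.trans hk),
    fun j hj => h.ext j (hj.trans hk)⟩

theorem evalDual_injective_of_injective {X G : Type u} [AddCommGroup X] [Module A X]
    [AddCommGroup G] [Module A G] {f : X →ₗ[A] G} (hf : Injective f)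
    (hG : Injective (evalDual A G)) : Injective (evalDual A X) := fun _ _ hxy =>
  hf <| hG <| LinearMap.ext fun φ => LinearMap.congr_fun hxy (φ ∘ₗ f)

theorem IsTorsionFree.of_isShortExact {X G Y : Type u} [AddCommGroup X] [Module A X]
    [AddCommGroup G] [Module A G] [AddCommGroup Y] [Module A Y] {f : X →ₗ[A] G} {g : G →ₗ[A] Y}
    (h : IsShortExact f g) (hf : Surjective (dualMap f)) {k : ℕ}
    (hG : IsTorsionFree A G (k + 1 : ℕ)) (hY : IsTorsionFree A Y k) :
    IsTorsionFree A X (k + 1 : ℕ) := by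
  have hdual : IsShortExact (dualMap g) (dualMap f) :=
    ⟨dualMap_injective h.surjective, hf, dualMap_exact h.surjective h.exact⟩
  refine ⟨fun hk => evalDual_injective_of_injective h.injective (hG.injective hk),
    fun hk φ => ?_, ?_⟩
  · obtain ⟨y, hy⟩ := hG.surjective hk (φ ∘ₗ dualMap f)
    have hk' : (1 : ℕ∞) ≤ k := by
      have : 2 ≤ k + 1 := by exact_mod_cast hk
      exact_mod_cast (by omega : 1 ≤ k)
    obtain ⟨x, rfl⟩ := (h.exact y).1 <| hY.injective hk' <| LinearMap.ext fun ψ => by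
      refine (LinearMap.congr_fun hy (dualMap g ψ)).trans ?_
      rw [LinearMap.comp_apply, hdual.exact.apply_apply_eq_zero]
      simp
    refine ⟨x, (LinearMap.cancel_right hf).1 ?_⟩
    rw [← hy]
    rfl
  · intro j hj
    have hjk : j + 3 ≤ k + 1 := by exact_mod_cast hj
    cases j with
    | zero =>
      refine hdual.extSubsingleton_zero (hG.ext 0 hj) fun φ => ?_
      obtain ⟨y, rfl⟩ := hY.surjective (by exact_mod_cast (by omega : 2 ≤ k)) φ
      obtain ⟨x, rfl⟩ := h.surjective y
      exact ⟨evalDual A G x, rfl⟩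
    | succ j =>
      exact hdual.extSubsingleton_succ (hG.ext (j + 1) hj)
        (hY.ext j (by exact_mod_cast (by omega : j + 3 ≤ k)))

/-- Exactness of the dual sequence at the middle term lets one extend functionals. -/
theorem exists_comp_eq_of_exact_dual {P₂ P₁ P₀ X : Type u} [AddCommGroup P₂] [Module A P₂]
    [AddCommGroup P₁] [Module A P₁] [AddCommGroup P₀] [Module A P₀] [AddCommGroup X] [Module A X]
    {f : P₂ →ₗ[A] P₁} {g : P₁ →ₗ[A] P₀}
    (h : Exact (fun φ : P₀ →ₗ[A] A => φ.comp g) (fun φ : P₁ →ₗ[A] A => φ.comp f))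
    {p : P₁ →ₗ[A] X} (hp : ∀ x, p (f x) = 0) (φ : X →ₗ[A] A) :
    ∃ ψ : P₀ →ₗ[A] A, ψ ∘ₗ g = φ ∘ₗ p :=
  (h (φ ∘ₗ p)).1 <| LinearMap.ext fun x => by simp [hp]

theorem nodeIn_natCast_add_one {m n : ℕ∞} {t : ℕ} :
    nodeIn m n ((t : ℤ) + 1) ↔ (t : ℕ∞) + 1 ≤ m := by
  have h : ((t : ℤ) + 1).toNat = t + 1 := by omega
  simp only [nodeIn, h]
  push_cast
  exact ⟨fun h => h.1 (by omega), fun h => ⟨fun _ => h, fun h => by omega⟩⟩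

theorem nodeIn_neg_natCast {m n : ℕ∞} {t : ℕ} : nodeIn m n (-(t : ℤ)) ↔ (t : ℕ∞) + 1 ≤ n := by
  have h : (1 - -(t : ℤ)).toNat = t + 1 := by omega
  simp only [nodeIn, h]
  push_cast
  exact ⟨fun h => h.2 (by omega), fun h => ⟨fun h => by omega, fun _ => h⟩⟩

theorem posIn_natCast {m n : ℕ∞} {t : ℕ} (h : (t : ℕ∞) ≤ m) : posIn m n t :=
  ⟨fun _ => by simpa using h.trans le_self_add, fun h => by omega⟩

theorem posIn_neg_natCast_add_one {m n : ℕ∞} {t : ℕ} (h : (t : ℕ∞) + 1 ≤ n) :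
    posIn m n (-((t : ℤ) + 1)) := by
  refine ⟨fun h => by omega, fun _ => ?_⟩
  rw [neg_neg, show ((t : ℤ) + 1).toNat = t + 1 by omega]
  exact_mod_cast h

variable {S : ZSeq A} {m n : ℕ∞}

theorem extSubsingleton_of_sequence
    (hS : ∀ i : ℤ, posIn m n i → ∀ j : ℕ, (j : ℕ∞) + 1 ≤ m → ExtSubsingleton A (S.P i) A j)
    (hex : ∀ i : ℤ, nodeIn m n (i + 1) → Exact (S.d (i + 1)) (S.d i))
    (hdual : ∀ i : ℤ, nodeIn m n (i + 1) →
      Exact (fun φ : S.P i →ₗ[A] A => φ.comp (S.d i))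
        (fun φ : S.P (i + 1) →ₗ[A] A => φ.comp (S.d (i + 1))))
    (j : ℕ) : ∀ (t : ℕ) {X : Type u} [AddCommGroup X] [Module A X] (p : S.P t →ₗ[A] X),
      Surjective p → Exact (S.d t) p → (j : ℕ∞) + 1 + t ≤ m → ExtSubsingleton A X A j := by
  induction j with
  | zero =>
    intro t X _ _ p hp hdp hm
    have hm' : (t : ℕ∞) + 1 ≤ m := by simpa [add_comm] using hm
    refine (isShortExact_subtype_ker hp).extSubsingleton_zero
      (hS t (posIn_natCast (le_self_add.trans hm')) 0 (le_self_add.trans hm)) fun φ => ?_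
    have hnode : nodeIn m n ((t : ℤ) + 1) := nodeIn_natCast_add_one.2 hm'
    let q : S.P (t + 1) →ₗ[A] p.ker := (S.d t).codRestrict p.ker hdp.apply_apply_eq_zero
    obtain ⟨ψ, hψ⟩ := exists_comp_eq_of_exact_dual (hdual t hnode) (p := q)
      (fun x => Subtype.ext ((hex t hnode).apply_apply_eq_zero x)) φ
    refine ⟨ψ, LinearMap.ext fun x => ?_⟩
    obtain ⟨y, hy⟩ := (hdp x).1 x.2
    obtain rfl : q y = x := Subtype.ext hy
    exact LinearMap.congr_fun hψ y
  | succ j ih =>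
    intro t X _ _ p hp hdp hm
    have hm' : ((j + 1 + 1 + t : ℕ) : ℕ∞) ≤ m := by exact_mod_cast hm
    have hle : ∀ k : ℕ, k ≤ j + 1 + 1 + t → (k : ℕ∞) ≤ m := fun k hk =>
      le_trans (by exact_mod_cast hk) hm'
    have hnode : nodeIn m n ((t : ℤ) + 1) :=
      nodeIn_natCast_add_one.2 (by exact_mod_cast hle (t + 1) (by omega))
    refine (isShortExact_subtype_ker hp).extSubsingleton_succ
      (hS t (posIn_natCast (hle t (by omega))) (j + 1)
        (by exact_mod_cast hle (j + 1 + 1) (by omega))) ?_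
    refine ih (t + 1) ((S.d t).codRestrict p.ker hdp.apply_apply_eq_zero) ?_ ?_
      (by exact_mod_cast hle (j + 1 + (t + 1)) (by omega))
    · rintro ⟨x, hx⟩
      obtain ⟨y, rfl⟩ := (hdp x).1 hx
      exact ⟨y, rfl⟩
    · intro x
      refine Iff.trans ?_ (hex t hnode x)
      rw [Subtype.ext_iff]
      rfl

theorem isTorsionFree_of_sequence
    (hS : ∀ i : ℤ, posIn m n i → IsTorsionFree A (S.P i) n)
    (hex : ∀ i : ℤ, nodeIn m n (i + 1) → Exact (S.d (i + 1)) (S.d i))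
    (hdual : ∀ i : ℤ, nodeIn m n (i + 1) →
      Exact (fun φ : S.P i →ₗ[A] A => φ.comp (S.d i))
        (fun φ : S.P (i + 1) →ₗ[A] A => φ.comp (S.d (i + 1))))
    (k : ℕ) : ∀ (t : ℕ) (i : ℤ), i = -((t : ℤ) + 1) →
      ∀ {X : Type u} [AddCommGroup X] [Module A X] (p : S.P (i + 1) →ₗ[A] X), Surjective p →
      (S.d i).ker = p.ker → (k : ℕ∞) + t ≤ n → IsTorsionFree A X k := by
  induction k with
  | zero => exact fun _ _ _ _ _ _ _ _ _ _ => ⟨by simp, by simp, by simp⟩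
  | succ k ih =>
    intro t i hi X _ _ p hp hker hn
    have hn' : ((k + 1 + t : ℕ) : ℕ∞) ≤ n := by exact_mod_cast hn
    have hle : ∀ l : ℕ, l ≤ k + 1 + t → (l : ℕ∞) ≤ n := fun l hl =>
      le_trans (by exact_mod_cast hl) hn'
    have hnode : nodeIn m n (i + 1) := by
      rw [hi, show -((t : ℤ) + 1) + 1 = -t by ring, nodeIn_neg_natCast]
      exact_mod_cast hle (t + 1) (by omega)
    obtain ⟨f, hf⟩ := LinearMap.exists_comp_eq_of_ker_le hp (S.d i) hker.ge
    have hfinj : Injective f := by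
      rw [injective_iff_map_eq_zero]
      intro x hx
      obtain ⟨y, rfl⟩ := hp x
      change y ∈ p.ker
      rw [← hker, ← hf]
      exact hx
    have hfdual : Surjective (dualMap f) := fun φ => by
      obtain ⟨ψ, hψ⟩ := exists_comp_eq_of_exact_dual (hdual i hnode) (p := p)
        (fun x => hker.le ((hex i hnode).apply_apply_eq_zero x)) φ
      refine ⟨ψ, (LinearMap.cancel_right hp).1 ?_⟩
      rw [← hψ, ← hf]
      rfl
    have hG : IsTorsionFree A (S.P i) (k + 1 : ℕ) := by
      refine (hS i ?_).mono (hle _ (by omega))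
      rw [hi]
      exact posIn_neg_natCast_add_one (by exact_mod_cast hle (t + 1) (by omega))
    rcases Nat.eq_zero_or_pos k with rfl | hk
    · exact ⟨fun h => evalDual_injective_of_injective hfinj (hG.injective h),
        fun h => absurd h (by norm_num), fun j hj => absurd hj (by norm_cast)⟩
    · obtain ⟨i, rfl⟩ : ∃ i' : ℤ, i = i' + 1 := ⟨i - 1, by ring⟩
      have hnode' : nodeIn m n (i + 1) := by
        rw [hi, show -((t : ℤ) + 1) = -((t + 1 : ℕ) : ℤ) by push_cast; ring, nodeIn_neg_natCast]
        exact_mod_cast hle (t + 1 + 1) (by omega)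
      refine IsTorsionFree.of_isShortExact (Y := (S.d i).range) (g := (S.d i).rangeRestrict)
        ⟨hfinj, (S.d i).surjective_rangeRestrict, fun x => ?_⟩ hfdual hG <|
        ih (t + 1) i (by push_cast; linarith) _ (S.d i).surjective_rangeRestrict
          (LinearMap.ker_rangeRestrict _).symm (by exact_mod_cast hle (k + (t + 1)) (by omega))
      rw [Subtype.ext_iff]
      refine (hex i hnode' x).trans ?_
      rw [← hf, LinearMap.coe_comp, hp.range_comp]

end Sequence

section Splice

variable {A : Type u} [Ring A] {M : Type u} [AddCommGroup M] [Module A M]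

/-- The dual `Hom(-, A)` of a map of modules on the other side. -/
def dualMapOp {N N' : Type u} [AddCommGroup N] [Module Aᵐᵒᵖ N] [AddCommGroup N'] [Module Aᵐᵒᵖ N']
    (f : N →ₗ[Aᵐᵒᵖ] N') : (N' →ₗ[Aᵐᵒᵖ] A) →ₗ[A] (N →ₗ[Aᵐᵒᵖ] A) where
  toFun φ := φ.comp f
  map_add' _ _ := rfl
  map_smul' _ _ := rfl

@[simp]
theorem dualMapOp_apply_apply {N N' : Type u} [AddCommGroup N] [Module Aᵐᵒᵖ N] [AddCommGroup N']
    [Module Aᵐᵒᵖ N'] (f : N →ₗ[Aᵐᵒᵖ] N') (φ : N' →ₗ[Aᵐᵒᵖ] A) (x : N) :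
    dualMapOp f φ x = φ (f x) := rfl

instance (r : ℕ) : Module.Free A ((Fin r → Aᵐᵒᵖ) →ₗ[Aᵐᵒᵖ] A) :=
  Module.Free.of_equiv (LinearEquiv.piRing Aᵐᵒᵖ A (Fin r) A).symm

instance (r : ℕ) : Module.Finite A ((Fin r → Aᵐᵒᵖ) →ₗ[Aᵐᵒᵖ] A) :=
  Module.Finite.equiv (LinearEquiv.piRing Aᵐᵒᵖ A (Fin r) A).symm

variable (F : FreeResolution A M) (Q : FreeResolution Aᵐᵒᵖ (M →ₗ[A] A))

/-- The composite `F₀ → M → M** → Q₀*` joining a resolution of `M` to the dual of a resolution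
of `M*`. -/
def spliceMap : (Fin (F.rank 0) → A) →ₗ[A] ((Fin (Q.rank 0) → Aᵐᵒᵖ) →ₗ[Aᵐᵒᵖ] A) :=
  dualMapOp Q.aug ∘ₗ evalDual A M ∘ₗ F.aug

@[simp]
theorem spliceMap_apply_apply (x : Fin (F.rank 0) → A) (q : Fin (Q.rank 0) → Aᵐᵒᵖ) :
    spliceMap F Q x q = Q.aug q (F.aug x) := rfl

/-- The terms of the sequence `⋯ → F₁ → F₀ → Q₀* → Q₁* → ⋯`. -/
def SpliceTerm : ℤ → Type u
  | Int.ofNat k => Fin (F.rank k) → A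
  | Int.negSucc k => (Fin (Q.rank k) → Aᵐᵒᵖ) →ₗ[Aᵐᵒᵖ] A

instance : ∀ i, AddCommGroup (SpliceTerm F Q i)
  | Int.ofNat k => inferInstanceAs (AddCommGroup (Fin (F.rank k) → A))
  | Int.negSucc k => inferInstanceAs (AddCommGroup ((Fin (Q.rank k) → Aᵐᵒᵖ) →ₗ[Aᵐᵒᵖ] A))

instance : ∀ i, Module A (SpliceTerm F Q i)
  | Int.ofNat k => inferInstanceAs (Module A (Fin (F.rank k) → A))
  | Int.negSucc k => inferInstanceAs (Module A ((Fin (Q.rank k) → Aᵐᵒᵖ) →ₗ[Aᵐᵒᵖ] A))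

/-- The sequence `⋯ → F₁ → F₀ → Q₀* → Q₁* → ⋯`. -/
def spliceSeq : ZSeq A where
  P := SpliceTerm F Q
  d
    | Int.ofNat k => F.d k
    | Int.negSucc 0 => spliceMap F Q
    | Int.negSucc (k + 1) => dualMapOp (Q.d k)

theorem ker_spliceMap (h : Injective (evalDual A M)) : (spliceMap F Q).ker = F.aug.ker := by
  ext x
  simp only [LinearMap.mem_ker]
  constructor
  · intro hx
    refine (injective_iff_map_eq_zero _).1 h _ (LinearMap.ext fun f => ?_)
    obtain ⟨q, rfl⟩ := Q.aug_surjective f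
    exact LinearMap.congr_fun hx q
  · intro hx
    refine LinearMap.ext fun q => ?_
    simp [hx]

theorem exact_spliceMap_dualMapOp (h : Surjective (evalDual A M)) :
    Exact (spliceMap F Q) (dualMapOp (A := A) (Q.d 0)) := by
  intro φ
  constructor
  · intro hφ
    obtain ⟨ψ, rfl⟩ := LinearMap.exists_comp_eq_of_ker_le Q.aug_surjective φ <| by
      intro q hq
      obtain ⟨r, rfl⟩ := (Q.exact_aug q).1 hq
      exact LinearMap.congr_fun hφ r
    obtain ⟨x, rfl⟩ := h ψ
    obtain ⟨y, rfl⟩ := F.aug_surjective x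
    exact ⟨y, rfl⟩
  · rintro ⟨x, rfl⟩
    refine LinearMap.ext fun q => ?_
    simp [Q.exact_aug.apply_apply_eq_zero]

theorem exact_comp_spliceMap_comp :
    Exact (fun φ : ((Fin (Q.rank 0) → Aᵐᵒᵖ) →ₗ[Aᵐᵒᵖ] A) →ₗ[A] A => φ.comp (spliceMap F Q))
      (fun φ : (Fin (F.rank 0) → A) →ₗ[A] A => φ.comp (F.d 0)) := by
  intro φ
  constructor
  · intro hφ
    obtain ⟨f, rfl⟩ := (dualMap_exact F.aug_surjective F.exact_aug φ).1 hφ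
    obtain ⟨q, rfl⟩ := Q.aug_surjective f
    exact ⟨LinearMap.applyₗ' A q, rfl⟩
  · rintro ⟨ψ, rfl⟩
    refine LinearMap.ext fun x => ?_
    have : spliceMap F Q (F.d 0 x) = 0 := by
      refine LinearMap.ext fun q => ?_
      simp [F.exact_aug.apply_apply_eq_zero]
    simp [this]

theorem exact_comp_dualMapOp_comp_spliceMap :
    Exact (fun φ : ((Fin (Q.rank 1) → Aᵐᵒᵖ) →ₗ[Aᵐᵒᵖ] A) →ₗ[A] A => φ.comp (dualMapOp (Q.d 0)))
      (fun φ : ((Fin (Q.rank 0) → Aᵐᵒᵖ) →ₗ[Aᵐᵒᵖ] A) →ₗ[A] A => φ.comp (spliceMap F Q)) := by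
  intro φ
  constructor
  · intro hφ
    obtain ⟨q, hq⟩ := exists_eval_of_free_op φ
    obtain ⟨r, rfl⟩ := (Q.exact_aug q).1 <| (LinearMap.cancel_right F.aug_surjective).1 <|
      LinearMap.ext fun x => (hq (spliceMap F Q x)).symm.trans (LinearMap.congr_fun hφ x)
    exact ⟨LinearMap.applyₗ' A r, LinearMap.ext fun f => (hq f).symm⟩
  · rintro ⟨ψ, rfl⟩
    refine LinearMap.ext fun x => ?_
    have : dualMapOp (A := A) (Q.d 0) (spliceMap F Q x) = 0 := by
      refine LinearMap.ext fun q => ?_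
      simp [Q.exact_aug.apply_apply_eq_zero]
    simp [this]

theorem exact_comp_dualMapOp {Q₂ Q₁ Q₀ : Type u} [AddCommGroup Q₂] [Module Aᵐᵒᵖ Q₂]
    [AddCommGroup Q₁] [Module Aᵐᵒᵖ Q₁] [Module.Free Aᵐᵒᵖ Q₁] [Module.Finite Aᵐᵒᵖ Q₁]
    [AddCommGroup Q₀] [Module Aᵐᵒᵖ Q₀] [Module.Free Aᵐᵒᵖ Q₀]
    {f : Q₂ →ₗ[Aᵐᵒᵖ] Q₁} {g : Q₁ →ₗ[Aᵐᵒᵖ] Q₀} (h : Exact f g) :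
    Exact (fun φ : (Q₂ →ₗ[Aᵐᵒᵖ] A) →ₗ[A] A => φ.comp (dualMapOp f))
      (fun φ : (Q₁ →ₗ[Aᵐᵒᵖ] A) →ₗ[A] A => φ.comp (dualMapOp g)) := by
  intro φ
  constructor
  · intro hφ
    obtain ⟨q, hq⟩ := exists_eval_of_free_op φ
    obtain ⟨r, rfl⟩ := (h q).1 <| eq_zero_of_free_op fun ψ : Q₀ →ₗ[Aᵐᵒᵖ] A =>
      (hq (dualMapOp g ψ)).symm.trans (LinearMap.congr_fun hφ ψ)
    exact ⟨LinearMap.applyₗ' A r, LinearMap.ext fun f => (hq f).symm⟩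
  · rintro ⟨ψ, rfl⟩
    refine LinearMap.ext fun x => ?_
    have : dualMapOp (A := A) f (dualMapOp g x) = 0 := by
      refine LinearMap.ext fun q => ?_
      simp [h.apply_apply_eq_zero]
    simp [this]

theorem le_of_nodeIn_negSucc {m n : ℕ∞} {k : ℕ} (h : nodeIn m n (Int.negSucc k + 1)) :
    (k : ℕ∞) + 1 ≤ n := by
  rwa [show Int.negSucc k + 1 = -(k : ℤ) by omega, nodeIn_neg_natCast] at h

theorem exact_spliceSeq {m n : ℕ∞} (h : IsTorsionFree A M n) :
    ∀ i : ℤ, nodeIn m n (i + 1) → Exact ((spliceSeq F Q).d (i + 1)) ((spliceSeq F Q).d i)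
  | Int.ofNat k, _ => F.exact k
  | Int.negSucc 0, hi => by
    have hker := ker_spliceMap F Q (h.injective (by simpa using le_of_nodeIn_negSucc hi))
    exact LinearMap.exact_iff.2 (hker.trans (LinearMap.exact_iff.1 F.exact_aug))
  | Int.negSucc 1, hi => exact_spliceMap_dualMapOp F Q <|
      h.surjective (by simpa [one_add_one_eq_two] using le_of_nodeIn_negSucc hi)
  | Int.negSucc (k + 2), hi => (Q.exact_hom_iff A k).2 <|
      h.ext k (by exact_mod_cast le_of_nodeIn_negSucc hi)

theorem exact_dual_spliceSeq {m n : ℕ∞} (h : ∀ j : ℕ, (j : ℕ∞) + 1 ≤ m → ExtSubsingleton A M A j) :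
    ∀ i : ℤ, nodeIn m n (i + 1) →
      Exact (fun φ : (spliceSeq F Q).P i →ₗ[A] A => φ.comp ((spliceSeq F Q).d i))
        (fun φ : (spliceSeq F Q).P (i + 1) →ₗ[A] A => φ.comp ((spliceSeq F Q).d (i + 1)))
  | Int.ofNat k, hi => (F.exact_hom_iff A k).2 (h k (nodeIn_natCast_add_one.1 hi))
  | Int.negSucc 0, _ => exact_comp_spliceMap_comp F Q
  | Int.negSucc 1, _ => exact_comp_dualMapOp_comp_spliceMap F Q
  | Int.negSucc (k + 2), _ => exact_comp_dualMapOp (Q.exact k)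

theorem finite_and_isMNTorsionFree_spliceSeq [IsNoetherianRing A] [IsNoetherianRing Aᵐᵒᵖ]
    (m n : ℕ∞) : ∀ i : ℤ, Module.Finite A ((spliceSeq F Q).P i) ∧
      IsMNTorsionFree A ((spliceSeq F Q).P i) m n
  | Int.ofNat k =>
    have h : IsMNTorsionFree A (Fin (F.rank k) → A) m n := isMNTorsionFree_of_free m n
    ⟨inferInstanceAs (Module.Finite A (Fin (F.rank k) → A)), h⟩
  | Int.negSucc k =>
    have h : IsMNTorsionFree A ((Fin (Q.rank k) → Aᵐᵒᵖ) →ₗ[Aᵐᵒᵖ] A) m n :=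
      isMNTorsionFree_of_free m n
    ⟨inferInstanceAs (Module.Finite A ((Fin (Q.rank k) → Aᵐᵒᵖ) →ₗ[Aᵐᵒᵖ] A)), h⟩

end Splice

/-- **Theorem 1.1 / Theorem 2.2 (1)⇔(3) (Araya–Takahashi).**
Let `Λ` be a left and right noetherian ring, `m, n ∈ ℕ ∪ {∞}` and `M` a finitely
generated (right) `Λ`-module.  Then `M` is `(m,n)`-torsionfree if and only if there
exists an exact sequence `σ : G_{m+1} → G_m → ⋯ → G_0 →∂ G_{-1} → ⋯ → G_{-n}` of
finitely generated `(m,n)`-torsionfree `Λ`-modules such that `σ*` is also exact and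
the image of `∂` is isomorphic to `M`.

The sequence is encoded by a `ℤ`-indexed family `S` together with an epimorphism
`π : G_0 → M` onto the image of `∂ = S.d (-1)` (see the encoding explained in the
statement of Theorem 2.2 (1)⇔(2)). -/
theorem isMNTorsionFree_iff_exists_torsionfree_sequence
    (A : Type u) [Ring A] [IsNoetherianRing A] [IsNoetherianRing Aᵐᵒᵖ]
    (M : Type u) [AddCommGroup M] [Module A M] [Module.Finite A M] (m n : ℕ∞) :
    IsMNTorsionFree A M m n ↔
      ∃ (S : ZSeq A) (π : S.P 0 →ₗ[A] M),
        (∀ i : ℤ, posIn m n i →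
          Module.Finite A (S.P i) ∧ IsMNTorsionFree A (S.P i) m n) ∧
        Function.Surjective π ∧
        Function.Exact (S.d 0) π ∧
        (1 ≤ n → LinearMap.ker (S.d (-1)) = LinearMap.ker π) ∧
        (∀ i : ℤ, nodeIn m n (i + 1) → Function.Exact (S.d (i + 1)) (S.d i)) ∧
        (∀ i : ℤ, nodeIn m n (i + 1) →
          Function.Exact (fun φ : S.P i →ₗ[A] A => φ.comp (S.d i))
            (fun φ : S.P (i + 1) →ₗ[A] A => φ.comp (S.d (i + 1)))) := by
  constructor
  · intro h
    obtain ⟨hm, hn⟩ := (isMNTorsionFree_iff m n).1 h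
    have := finite_dual (A := A) (M := M)
    obtain ⟨F⟩ := nonempty_freeResolution (A := A) (M := M)
    obtain ⟨Q⟩ := nonempty_freeResolution (A := Aᵐᵒᵖ) (M := M →ₗ[A] A)
    exact ⟨spliceSeq F Q, F.aug, fun i _ => finite_and_isMNTorsionFree_spliceSeq F Q m n i,
      F.aug_surjective, F.exact_aug, fun h1 => ker_spliceMap F Q (hn.injective h1),
      exact_spliceSeq F Q hn, exact_dual_spliceSeq F Q hm⟩
  · rintro ⟨S, π, hS, hπ, hdπ, hker, hex, hdual⟩
    have hS' : ∀ i, posIn m n i → (∀ j : ℕ, (j : ℕ∞) + 1 ≤ m → ExtSubsingleton A (S.P i) A j) ∧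
        IsTorsionFree A (S.P i) n := fun i hi =>
      have := (hS i hi).1
      (isMNTorsionFree_iff m n).1 (hS i hi).2
    have htf : ∀ k : ℕ, 1 ≤ k → (k : ℕ∞) ≤ n → IsTorsionFree A M k := fun k hk hkn =>
      isTorsionFree_of_sequence (fun i hi => (hS' i hi).2) hex hdual k 0 (-1) rfl π hπ
        (hker (le_trans (by exact_mod_cast hk) hkn)) (by simpa using hkn)
    refine (isMNTorsionFree_iff m n).2 ⟨fun j hj => ?_, fun hn => ?_, fun hn => ?_, fun j hj => ?_⟩
    · exact extSubsingleton_of_sequence (fun i hi => (hS' i hi).1) hex hdual j 0 π hπ hdπ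
        (by simpa using hj)
    · exact (htf 1 le_rfl (by exact_mod_cast hn)).injective (by simp)
    · exact (htf 2 (by omega) (by exact_mod_cast hn)).surjective (by simp)
    · exact (htf (j + 3) (by omega) (by exact_mod_cast hj)).ext j (by simp)
end

section
/- Let Λ be a left and right noetherian ring, let m ∈ ℕ ∪ {∞}, and let M be a finitely generated right Λ-module. Suppose there is an exact sequence σ : G_{m+1} → G_m → ⋯ → G₁ → G₀ → M → 0 of finitely generated Λ-modules such that Ext^i_Λ(G_j, Λ) = 0 for all 1 ≤ i ≤ m and all 0 ≤ j ≤ m+1, and such that the Λ-dual sequence σ* is also exact. Then Ext^i_Λ(M, Λ) = 0 for all 1 ≤ i ≤ m. -/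
/-!
Formalization of a statement from:
T. Araya and R. Takahashi, "On reducing homological dimensions over noetherian
rings" (arXiv:2010.10765).
-/

open Function Filter CategoryTheory

universe u

/-- An `ℕ`-indexed sequence of `A`-modules `⋯ → G_2 → G_1 → G_0`. -/
structure NSeq (A : Type u) [Ring A] where
  G : ℕ → Type u
  [acg : ∀ i, AddCommGroup (G i)]
  [mod : ∀ i, Module A (G i)]
  d : ∀ i : ℕ, G (i + 1) →ₗ[A] G i

attribute [instance] NSeq.acg NSeq.mod

section ExtVanishing

variable {A : Type u} [Ring A]

/-- The short exact sequence `0 → range f → X → M → 0` attached to an exact sequence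
`Y → X → M → 0`. -/
abbrev rangeShortComplex {Y X M : Type u} [AddCommGroup Y] [Module A Y] [AddCommGroup X]
    [Module A X] [AddCommGroup M] [Module A M] (f : Y →ₗ[A] X) (p : X →ₗ[A] M)
    (h : Function.Exact f p) : ShortComplex (ModuleCat.{u} A) :=
  ShortComplex.mk (ModuleCat.ofHom (LinearMap.range f).subtype) (ModuleCat.ofHom p) (by
    ext ⟨_, y, rfl⟩
    exact h.apply_apply_eq_zero y)

variable {Y X M N : Type u} [AddCommGroup Y] [Module A Y] [AddCommGroup X] [Module A X]
  [AddCommGroup M] [Module A M] [AddCommGroup N] [Module A N]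

theorem rangeShortComplex_shortExact {f : Y →ₗ[A] X} {p : X →ₗ[A] M}
    (h : Function.Exact f p) (hp : Function.Surjective p) :
    (rangeShortComplex f p h).ShortExact where
  exact := (ShortComplex.ShortExact.moduleCat_exact_iff_function_exact _).mpr fun x => by
    simpa using h x
  mono_f := (ModuleCat.mono_iff_injective _).mpr Subtype.val_injective
  epi_g := (ModuleCat.epi_iff_surjective _).mpr hp

/-- `Ext¹(M, N) = 0` if and only if every linear map `range f → N` extends to `X`,
for an exact sequence `Y → X → M → 0` with `Ext¹(X, N) = 0`. -/
theorem subsingleton_ext_one_iff {f : Y →ₗ[A] X} {p : X →ₗ[A] M}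
    (h : Function.Exact f p) (hp : Function.Surjective p)
    (hX : Subsingleton (Abelian.Ext (ModuleCat.of A X) (ModuleCat.of A N) 1)) :
    Subsingleton (Abelian.Ext (ModuleCat.of A M) (ModuleCat.of A N) 1) ↔
      ∀ φ : LinearMap.range f →ₗ[A] N, ∃ ψ : X →ₗ[A] N,
        ψ.comp (LinearMap.range f).subtype = φ := by
  have hS := rangeShortComplex_shortExact h hp
  constructor
  · intro hM φ
    obtain ⟨x, hx⟩ := Abelian.Ext.contravariant_sequence_exact₁ hS (ModuleCat.of A N)
      (Abelian.Ext.mk₀ (ModuleCat.ofHom φ)) (add_zero 1) (hM.elim _ _)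
    obtain ⟨ψ, rfl⟩ := (Abelian.Ext.mk₀_bijective _ _).2 x
    rw [Abelian.Ext.mk₀_comp_mk₀] at hx
    exact ⟨ψ.hom, congrArg ModuleCat.Hom.hom ((Abelian.Ext.mk₀_bijective _ _).1 hx)⟩
  · intro hφ
    refine subsingleton_of_forall_eq 0 fun x => ?_
    obtain ⟨y, rfl⟩ := Abelian.Ext.contravariant_sequence_exact₃ hS (ModuleCat.of A N) x
      (hX.elim _ _) (add_zero 1)
    obtain ⟨φ, rfl⟩ := (Abelian.Ext.mk₀_bijective _ _).2 y
    obtain ⟨ψ, hψ⟩ := hφ φ.hom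
    have : φ = (rangeShortComplex f p h).f ≫ ModuleCat.ofHom ψ := ModuleCat.hom_ext hψ.symm
    rw [this, ← Abelian.Ext.mk₀_comp_mk₀, hS.extClass_comp_assoc]

/-- Dimension shifting along an exact sequence `Y → X → M → 0`. -/
theorem subsingleton_ext_succ_iff {f : Y →ₗ[A] X} {p : X →ₗ[A] M}
    (h : Function.Exact f p) (hp : Function.Surjective p) (n : ℕ)
    (hX : Subsingleton (Abelian.Ext (ModuleCat.of A X) (ModuleCat.of A N) n))
    (hX' : Subsingleton (Abelian.Ext (ModuleCat.of A X) (ModuleCat.of A N) (n + 1))) :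
    Subsingleton (Abelian.Ext (ModuleCat.of A M) (ModuleCat.of A N) (n + 1)) ↔
      Subsingleton
        (Abelian.Ext (ModuleCat.of A (LinearMap.range f)) (ModuleCat.of A N) n) := by
  have hS := rangeShortComplex_shortExact h hp
  constructor
  · intro hM
    refine subsingleton_of_forall_eq 0 fun x => ?_
    obtain ⟨y, rfl⟩ := Abelian.Ext.contravariant_sequence_exact₁ hS (ModuleCat.of A N) x
      (add_comm 1 n) (hM.elim _ _)
    rw [hX.elim y 0, Abelian.Ext.comp_zero]
  · intro hK
    refine subsingleton_of_forall_eq 0 fun x => ?_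
    obtain ⟨y, rfl⟩ := Abelian.Ext.contravariant_sequence_exact₃ hS (ModuleCat.of A N) x
      (hX'.elim _ _) (add_comm 1 n)
    rw [hK.elim y 0, Abelian.Ext.comp_zero]

/-- For an exact sequence `Z → Y → X`, every linear map `range f → N` extends to `X` if and only
if `Hom(X, N) → Hom(Y, N) → Hom(Z, N)` is exact. -/
theorem forall_exists_extend_range_iff_exact {Z : Type u} [AddCommGroup Z] [Module A Z]
    {g : Z →ₗ[A] Y} {f : Y →ₗ[A] X} (h : Function.Exact g f) :
    (∀ φ : LinearMap.range f →ₗ[A] N, ∃ ψ : X →ₗ[A] N,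
        ψ.comp (LinearMap.range f).subtype = φ) ↔
      Function.Exact (fun φ : X →ₗ[A] N => φ.comp f) (fun φ : Y →ₗ[A] N => φ.comp g) := by
  constructor
  · intro H φ
    constructor
    · intro hφ
      have hker : LinearMap.ker f ≤ LinearMap.ker φ := by
        intro y hy
        obtain ⟨z, rfl⟩ := (h y).mp hy
        exact LinearMap.congr_fun hφ z
      obtain ⟨ψ, hψ⟩ := H (((LinearMap.ker f).liftQ φ hker).comp
        f.quotKerEquivRange.symm.toLinearMap)
      refine ⟨ψ, LinearMap.ext fun y => ?_⟩
      simpa [LinearMap.quotKerEquivRange_symm_apply_image f y ⟨y, rfl⟩] using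
        LinearMap.congr_fun hψ ⟨f y, y, rfl⟩
    · rintro ⟨ψ, rfl⟩
      ext z
      simp [h.apply_apply_eq_zero z]
  · intro H φ
    obtain ⟨ψ, hψ⟩ := (H (φ.comp f.rangeRestrict)).mp (by
      ext z
      have : f.rangeRestrict (g z) = 0 := Subtype.ext (h.apply_apply_eq_zero z)
      simp [this])
    refine ⟨ψ, ?_⟩
    ext ⟨_, y, rfl⟩
    exact LinearMap.congr_fun hψ y

/-- If `⋯ → G₁ → G₀ → M → 0` is exact and the relevant groups `Ext(Gⱼ, N)` vanish, then
`Ext^{k+1}(M, N)` vanishes exactly when the complex `Hom(G, N)` is exact at position `k + 1`. -/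
theorem NSeq.subsingleton_ext_iff_exact (k : ℕ) (S : NSeq A) (π : S.G 0 →ₗ[A] M)
    (hπ : Function.Surjective π) (hex0 : Function.Exact (S.d 0) π)
    (hex : ∀ i ≤ k, Function.Exact (S.d (i + 1)) (S.d i))
    (hG : ∀ j ≤ k, ∀ i ≤ k,
      Subsingleton (Abelian.Ext (ModuleCat.of A (S.G j)) (ModuleCat.of A N) (i + 1))) :
    Subsingleton (Abelian.Ext (ModuleCat.of A M) (ModuleCat.of A N) (k + 1)) ↔
      Function.Exact (fun φ : S.G k →ₗ[A] N => φ.comp (S.d k))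
        (fun φ : S.G (k + 1) →ₗ[A] N => φ.comp (S.d (k + 1))) := by
  induction k generalizing M S with
  | zero =>
    exact (subsingleton_ext_one_iff hex0 hπ (hG 0 le_rfl 0 le_rfl)).trans
      (forall_exists_extend_range_iff_exact (hex 0 le_rfl))
  | succ k ih =>
    refine (subsingleton_ext_succ_iff hex0 hπ (k + 1) (hG 0 (by simp) k (by simp))
      (hG 0 (by simp) (k + 1) le_rfl)).trans ?_
    refine ih { G := fun i => S.G (i + 1), d := fun i => S.d (i + 1) } (S.d 0).rangeRestrict
      (S.d 0).surjective_rangeRestrict (fun y => ?_) (fun i hi => hex (i + 1) (by lia))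
      (fun j hj i hi => hG (j + 1) (by lia) i (by lia))
    rw [← hex 0 (by simp) y, Subtype.ext_iff]
    rfl

/-- The sequence of free modules underlying a free resolution. -/
abbrev FreeResolution.toNSeq (F : FreeResolution A M) : NSeq A where
  G i := Fin (F.rank i) → A
  d := F.d

theorem FreeResolution.subsingleton_ext_iff_exact (F : FreeResolution A M) (k : ℕ) :
    Subsingleton (Abelian.Ext (ModuleCat.of A M) (ModuleCat.of A N) (k + 1)) ↔
      Function.Exact (fun φ : (Fin (F.rank k) → A) →ₗ[A] N => φ.comp (F.d k))
        (fun φ : (Fin (F.rank (k + 1)) → A) →ₗ[A] N => φ.comp (F.d (k + 1))) :=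
  F.toNSeq.subsingleton_ext_iff_exact k F.aug F.aug_surjective F.exact_aug
    (fun i _ => F.exact i) fun j _ i _ => by
      have : Projective (ModuleCat.of A (Fin (F.rank j) → A)) :=
        (IsProjective.iff_projective _).mp inferInstance
      exact Abelian.Ext.subsingleton_of_projective _ _ i

/-- A finitely generated module `M` over a noetherian ring has a resolution by finitely generated
free modules. -/
theorem FreeResolution.nonempty [IsNoetherianRing A] (M : Type u) [AddCommGroup M] [Module A M]
    [Module.Finite A M] : Nonempty (FreeResolution A M) := by
  obtain ⟨n₀, aug, haug⟩ := Module.Finite.exists_fin' A M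
  have step (n : ℕ) (K : Submodule A (Fin n → A)) :
      ∃ (l : ℕ) (g : (Fin l → A) →ₗ[A] (Fin n → A)), LinearMap.range g = K := by
    obtain ⟨l, g, hg⟩ := Module.Finite.exists_fin' A K
    exact ⟨l, K.subtype.comp g, by
      rw [LinearMap.range_comp, LinearMap.range_eq_top.mpr hg, Submodule.map_subtype_top]⟩
  choose l g hg using step
  let syz (s : Σ n, Submodule A (Fin n → A)) : Σ n, Submodule A (Fin n → A) :=
    ⟨l s.1 s.2, LinearMap.ker (g s.1 s.2)⟩
  let t (i : ℕ) : Σ n, Submodule A (Fin n → A) :=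
    Nat.rec ⟨n₀, LinearMap.ker aug⟩ (fun _ s => syz s) i
  exact ⟨{
    rank := fun i => (t i).1
    d := fun i => g (t i).1 (t i).2
    aug := aug
    aug_surjective := haug
    exact_aug := LinearMap.exact_iff.mpr (hg _ _).symm
    exact := fun i => LinearMap.exact_iff.mpr (hg _ _).symm }⟩

theorem extVanish_iff_subsingleton_ext [IsNoetherianRing A] [Module.Finite A M] (k : ℕ) :
    ExtVanish A M N k ↔
      Subsingleton (Abelian.Ext (ModuleCat.of A M) (ModuleCat.of A N) (k + 1)) := by
  refine ⟨fun h => ?_, fun h F => (F.subsingleton_ext_iff_exact k).mp h⟩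
  obtain ⟨F⟩ := FreeResolution.nonempty (A := A) M
  exact (F.subsingleton_ext_iff_exact k).mpr (h F)

end ExtVanishing

/-- **Claim (a) in the proof of Theorem 2.2 (Araya–Takahashi).**
Let `Λ` be a left and right noetherian ring, `m ∈ ℕ ∪ {∞}` and `M` a finitely
generated `Λ`-module.  Suppose there is an exact sequence
`σ : G_{m+1} → G_m → ⋯ → G_1 → G_0 →π M → 0` of finitely generated `Λ`-modules
such that `Ext_Λ^i(G_j, Λ) = 0` for all `1 ≤ i ≤ m`, `0 ≤ j ≤ m + 1`, and such
that the dual sequence `σ* : 0 → M* → G_0* → ⋯ → G_{m+1}*` is also exact.  Then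
`Ext_Λ^i(M, Λ) = 0` for all `1 ≤ i ≤ m`.  (Exactness is imposed at all interior
nodes of `σ` and of `σ*`.) -/
theorem ext_vanishing_of_sequence
    (A : Type u) [Ring A] [IsNoetherianRing A] [IsNoetherianRing Aᵐᵒᵖ]
    (M : Type u) [AddCommGroup M] [Module A M] [Module.Finite A M] (m : ℕ∞)
    (S : NSeq A) (π : S.G 0 →ₗ[A] M)
    (hfg : ∀ j : ℕ, (j : ℕ∞) ≤ m + 1 → Module.Finite A (S.G j))
    (hext : ∀ j : ℕ, (j : ℕ∞) ≤ m + 1 →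
      ∀ i : ℕ, (i : ℕ∞) + 1 ≤ m → ExtVanish A (S.G j) A i)
    (hπ : Function.Surjective π)
    (hex0 : Function.Exact (S.d 0) π)
    (hex : ∀ i : ℕ, (i : ℕ∞) + 1 ≤ m → Function.Exact (S.d (i + 1)) (S.d i))
    (hdual_inj : Function.Injective (fun φ : M →ₗ[A] A => φ.comp π))
    (hdual0 : Function.Exact (fun φ : M →ₗ[A] A => φ.comp π)
      (fun φ : S.G 0 →ₗ[A] A => φ.comp (S.d 0)))
    (hdual : ∀ i : ℕ, (i : ℕ∞) + 1 ≤ m →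
      Function.Exact (fun φ : S.G i →ₗ[A] A => φ.comp (S.d i))
        (fun φ : S.G (i + 1) →ₗ[A] A => φ.comp (S.d (i + 1)))) :
    ∀ i : ℕ, (i : ℕ∞) + 1 ≤ m → ExtVanish A M A i := by
  intro k hk
  have hle {i : ℕ} (hi : i ≤ k) : (i : ℕ∞) + 1 ≤ m :=
    le_trans (by gcongr) hk
  rw [extVanish_iff_subsingleton_ext,
    S.subsingleton_ext_iff_exact k π hπ hex0 (fun i hi => hex i (hle hi)) fun j hj i hi => ?_]
  · exact hdual k hk
  · have hj' : (j : ℕ∞) ≤ m + 1 := le_self_add.trans ((hle hj).trans le_self_add)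
    have := hfg j hj'
    exact (extVanish_iff_subsingleton_ext i).mp (hext j hj' i (hle hi))
end

section
/- Let Λ be a left and right noetherian ring. A finitely generated right Λ-module M is totally reflexive if and only if there exists an exact sequence ⋯ → G₁ → G₀ →∂ G_{-1} → G_{-2} → ⋯ of totally reflexive Λ-modules, unbounded in both directions, whose Λ-dual sequence is also exact and such that the image of ∂ is isomorphic to M. -/
/-!
Formalization of a statement from:
T. Araya and R. Takahashi, "On reducing homological dimensions over noetherian
rings" (arXiv:2010.10765).
-/

open Function Filter CategoryTheory

universe u

section ExtShift

variable {R : Type u} [Ring R] {K G M N : Type u} [AddCommGroup K] [Module R K]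
  [AddCommGroup G] [Module R G] [AddCommGroup M] [Module R M] [AddCommGroup N] [Module R N]

/-- `Ext_R^{n+1}(M, N) = 0`, in terms of the derived-category `Ext` groups. -/
def ExtZero (R : Type u) [Ring R] (M N : Type u) [AddCommGroup M] [Module R M]
    [AddCommGroup N] [Module R N] (n : ℕ) : Prop :=
  Subsingleton (Abelian.Ext (ModuleCat.of R M) (ModuleCat.of R N) (n + 1))

lemma ExtZero.of_projective [Module.Projective R M] (n : ℕ) : ExtZero R M N n :=
  Abelian.Ext.subsingleton_of_projective (ModuleCat.of R M) (ModuleCat.of R N) n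

lemma shortExact_ofHom {f : K →ₗ[R] G} {g : G →ₗ[R] M} (hf : Injective f)
    (hfg : Function.Exact f g) (hg : Surjective g) :
    (ModuleCat.shortComplexOfCompEqZero f g hfg.linearMap_comp_eq_zero).ShortExact :=
  ModuleCat.shortComplex_shortExact _ hfg hf hg

/-- If `Ext¹(G, N) = 0`, then `Ext¹(M, N) = 0` if and only if every map `K → N` extends to `G`,
for a short exact sequence `0 → K → G → M → 0`. -/
lemma extZero_zero_iff_extends {f : K →ₗ[R] G} {g : G →ₗ[R] M} (hf : Injective f)
    (hfg : Function.Exact f g) (hg : Surjective g) (hG : ExtZero R G N 0) :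
    ExtZero R M N 0 ↔ ∀ φ : K →ₗ[R] N, ∃ ψ : G →ₗ[R] N, ψ.comp f = φ := by
  have hS := shortExact_ofHom hf hfg hg
  constructor
  · intro hM φ
    have : Subsingleton (Abelian.Ext (ModuleCat.of R M) (ModuleCat.of R N) 1) := hM
    obtain ⟨x, hx⟩ := Abelian.Ext.contravariant_sequence_exact₁ hS (ModuleCat.of R N)
      (Abelian.Ext.mk₀ (ModuleCat.ofHom φ)) (add_zero 1) (Subsingleton.elim _ _)
    obtain ⟨ψ, rfl⟩ := (Abelian.Ext.mk₀_bijective _ _).2 x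
    rw [Abelian.Ext.mk₀_comp_mk₀] at hx
    have hψ := (Abelian.Ext.mk₀_bijective _ _).1 hx
    exact ⟨ψ.hom, congrArg ModuleCat.Hom.hom hψ⟩
  · intro h
    have : Subsingleton (Abelian.Ext (ModuleCat.of R G) (ModuleCat.of R N) 1) := hG
    refine subsingleton_of_forall_eq 0 fun x => ?_
    obtain ⟨y, rfl⟩ := Abelian.Ext.contravariant_sequence_exact₃ hS (ModuleCat.of R N) x
      (Subsingleton.elim (α := Abelian.Ext (ModuleCat.of R G) (ModuleCat.of R N) 1) _ _)
      (add_zero 1)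
    obtain ⟨φ, rfl⟩ := (Abelian.Ext.mk₀_bijective _ _).2 y
    obtain ⟨ψ, hψ⟩ := h φ.hom
    have hφ : φ = ModuleCat.ofHom f ≫ ModuleCat.ofHom ψ := ModuleCat.hom_ext hψ.symm
    rw [hφ, ← Abelian.Ext.mk₀_comp_mk₀]
    exact hS.extClass_comp_assoc _

/-- Dimension shifting along a short exact sequence `0 → K → G → M → 0`. -/
lemma extZero_succ_iff {f : K →ₗ[R] G} {g : G →ₗ[R] M} (hf : Injective f)
    (hfg : Function.Exact f g) (hg : Surjective g) (hG : ∀ n, ExtZero R G N n) (n : ℕ) :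
    ExtZero R M N (n + 1) ↔ ExtZero R K N n := by
  have hS := shortExact_ofHom hf hfg hg
  have hsub (n : ℕ) : Subsingleton (Abelian.Ext (ModuleCat.of R G) (ModuleCat.of R N) (n + 1)) :=
    hG n
  constructor
  · intro hM
    have : Subsingleton (Abelian.Ext (ModuleCat.of R M) (ModuleCat.of R N) (n + 1 + 1)) := hM
    refine subsingleton_of_forall_eq 0 fun x => ?_
    obtain ⟨y, rfl⟩ := Abelian.Ext.contravariant_sequence_exact₁ hS (ModuleCat.of R N) x
      (add_comm 1 (n + 1)) (Subsingleton.elim _ _)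
    have hy : y = 0 := (hsub n).elim _ _
    rw [hy, Abelian.Ext.comp_zero]
  · intro hK
    refine subsingleton_of_forall_eq 0 fun x => ?_
    obtain ⟨y, rfl⟩ := Abelian.Ext.contravariant_sequence_exact₃ hS (ModuleCat.of R N) x
      ((hsub (n + 1)).elim _ _) (add_comm 1 (n + 1))
    have hy : y = 0 := hK.elim _ _
    rw [hy, Abelian.Ext.comp_zero]

/-- If each `Z i` is the end of a short exact sequence `0 → Z j → G → Z i → 0` which stays exact
under `Hom(-, N)` and whose middle term has no higher `Ext` into `N`, then no `Z i` has higher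
`Ext` into `N`. -/
lemma extZero_of_forall_shortExact {ι : Type*} (Z : ι → Type u) [∀ i, AddCommGroup (Z i)]
    [∀ i, Module R (Z i)]
    (h : ∀ i, ∃ (j : ι) (G : Type u) (_ : AddCommGroup G) (_ : Module R G)
      (f : Z j →ₗ[R] G) (g : G →ₗ[R] Z i), Injective f ∧ Function.Exact f g ∧ Surjective g ∧
      (∀ n, ExtZero R G N n) ∧ ∀ φ : Z j →ₗ[R] N, ∃ ψ : G →ₗ[R] N, ψ.comp f = φ)
    (n : ℕ) (i : ι) : ExtZero R (Z i) N n := by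
  induction n generalizing i with
  | zero =>
    obtain ⟨j, G, _, _, f, g, hf, hfg, hg, hG, hext⟩ := h i
    exact (extZero_zero_iff_extends hf hfg hg (hG 0)).2 hext
  | succ n ih =>
    obtain ⟨j, G, _, _, f, g, hf, hfg, hg, hG, -⟩ := h i
    exact (extZero_succ_iff hf hfg hg hG n).2 (ih j)

/-- A linear map which vanishes on the kernel of a surjection factors through it. -/
lemma exists_comp_eq_of_ker_le {g : G →ₗ[R] M} (hg : Surjective g) (h : G →ₗ[R] N)
    (hk : ∀ x, g x = 0 → h x = 0) : ∃ ψ : M →ₗ[R] N, ψ.comp g = h := by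
  refine ⟨(g.ker.liftQ h hk).comp (g.quotKerEquivOfSurjective hg).symm.toLinearMap, ?_⟩
  ext x
  have : (g.quotKerEquivOfSurjective hg).symm (g x) = g.ker.mkQ x := by
    rw [LinearEquiv.symm_apply_eq]; rfl
  exact congrArg (g.ker.liftQ h hk) this

end ExtShift

namespace FreeResolution

section

variable {A : Type u} [Ring A] {M N : Type u} [AddCommGroup M] [Module A M]
  [AddCommGroup N] [Module A N]

/-- The resolution of the first syzygy obtained by deleting the term of degree `0`. -/
def syzygy_s4 (F : FreeResolution A M) : FreeResolution A (LinearMap.range (F.d 0)) where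
  rank i := F.rank (i + 1)
  d i := F.d (i + 1)
  aug := (F.d 0).rangeRestrict
  aug_surjective := (F.d 0).surjective_rangeRestrict
  exact_aug x := by
    rw [← F.exact 0 x, ← Subtype.val_inj]; rfl
  exact i := F.exact (i + 1)

/-- A resolution of `M` is also a resolution of any isomorphic module. -/
def ofEquiv (F : FreeResolution A M) (e : M ≃ₗ[A] N) : FreeResolution A N where
  rank := F.rank
  d := F.d
  aug := e.toLinearMap.comp F.aug
  aug_surjective := e.surjective.comp F.aug_surjective
  exact_aug x := by simpa using F.exact_aug x
  exact := F.exact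

lemma exact_subtype_aug (F : FreeResolution A M) :
    Function.Exact (LinearMap.range (F.d 0)).subtype F.aug := fun x => by
  simpa using F.exact_aug x

/-- The `Ext` groups are computed by any free resolution. -/
lemma exact_iff_extZero (F : FreeResolution A M) (j : ℕ) :
    Function.Exact
      (fun φ : (Fin (F.rank j) → A) →ₗ[A] N => φ.comp (F.d j))
      (fun φ : (Fin (F.rank (j + 1)) → A) →ₗ[A] N => φ.comp (F.d (j + 1))) ↔
      ExtZero A M N j := by
  induction j generalizing M with
  | zero =>
    rw [extZero_zero_iff_extends (Submodule.injective_subtype _) F.exact_subtype_aug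
      F.aug_surjective (.of_projective 0)]
    constructor
    · intro h φ
      obtain ⟨ψ, hψ⟩ := (h (φ.comp (F.d 0).rangeRestrict)).1 (by
        refine LinearMap.ext fun x => ?_
        have : (F.d 0).rangeRestrict (F.d 1 x) = 0 :=
          Subtype.ext ((F.exact 0).apply_apply_eq_zero x)
        simp [this])
      refine ⟨ψ, ?_⟩
      ext ⟨_, x, rfl⟩
      exact LinearMap.congr_fun hψ x
    · intro h φ
      constructor
      · intro hφ
        obtain ⟨ψ, hψ⟩ := exists_comp_eq_of_ker_le (F.d 0).surjective_rangeRestrict φ (by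
          intro x hx
          obtain ⟨y, rfl⟩ := (F.exact 0 x).1 (congrArg Subtype.val hx)
          exact LinearMap.congr_fun hφ y)
        obtain ⟨χ, rfl⟩ := h ψ
        exact ⟨χ, hψ⟩
      · rintro ⟨ψ, rfl⟩
        refine LinearMap.ext fun x => ?_
        simp [(F.exact 0).apply_apply_eq_zero x]
  | succ j ih =>
    rw [extZero_succ_iff (Submodule.injective_subtype _) F.exact_subtype_aug
      F.aug_surjective fun n => .of_projective n, ← ih F.syzygy_s4]
    rfl

lemma exists_exact_to [IsNoetherianRing A] {m : ℕ} (f : (Fin m → A) →ₗ[A] N) :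
    ∃ (k : ℕ) (g : (Fin k → A) →ₗ[A] (Fin m → A)), Function.Exact g f := by
  obtain ⟨k, g, hg⟩ := Module.Finite.exists_fin' A (LinearMap.ker f)
  refine ⟨k, (LinearMap.ker f).subtype.comp g, ?_⟩
  rw [LinearMap.exact_iff, LinearMap.range_comp, LinearMap.range_eq_top.2 hg]
  simp

/-- Finitely generated modules over a noetherian ring have resolutions by finite free modules. -/
lemma nonempty_of_finite [IsNoetherianRing A] [Module.Finite A M] :
    Nonempty (FreeResolution A M) := by
  obtain ⟨n, aug, haug⟩ := Module.Finite.exists_fin' A M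
  obtain ⟨m, d₀, hd₀⟩ := exists_exact_to aug
  choose k g hg using fun (p : Σ m n : ℕ, (Fin m → A) →ₗ[A] (Fin n → A)) => exists_exact_to p.2.2
  let s : ℕ → Σ m n : ℕ, (Fin m → A) →ₗ[A] (Fin n → A) :=
    fun i => Nat.rec ⟨m, n, d₀⟩ (fun _ p => ⟨k p, p.1, g p⟩) i
  exact ⟨{
    rank := fun i => (s i).2.1
    d := fun i => (s i).2.2
    aug := aug
    aug_surjective := haug
    exact_aug := hd₀
    exact := fun i => hg (s i) }⟩

end

end FreeResolution

lemma extVanish_iff_extZero {A : Type u} [Ring A] [IsNoetherianRing A] {M N : Type u}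
    [AddCommGroup M] [Module A M] [Module.Finite A M] [AddCommGroup N] [Module A N] (j : ℕ) :
    ExtVanish A M N j ↔ ExtZero A M N j := by
  obtain ⟨F⟩ := FreeResolution.nonempty_of_finite (A := A) (M := M)
  exact ⟨fun h => (F.exact_iff_extZero j).1 (h F), fun h F => (F.exact_iff_extZero j).2 h⟩

section Dual

variable {A : Type u} [Ring A]

/-- The canonical map `M → M**` is injective. -/
def IsTorsionless (A : Type u) [Ring A] (M : Type u) [AddCommGroup M] [Module A M] : Prop :=
  ∀ x : M, (∀ φ : M →ₗ[A] A, φ x = 0) → x = 0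

/-- The canonical map `M → M**` is surjective. -/
def EvalSurjective (A : Type u) [Ring A] (M : Type u) [AddCommGroup M] [Module A M] : Prop :=
  ∀ ψ : (M →ₗ[A] A) →ₗ[Aᵐᵒᵖ] A, ∃ x : M, ∀ φ, ψ φ = φ x

/-- The canonical map `M → M**`, at an element of `M`. -/
def evalAt {M : Type u} [AddCommGroup M] [Module A M] (x : M) : (M →ₗ[A] A) →ₗ[Aᵐᵒᵖ] A where
  toFun φ := φ x
  map_add' _ _ := rfl
  map_smul' _ _ := rfl

/-- The dual of a finite free module, in coordinates. -/
def dualPiEquiv (A : Type u) [Ring A] (n : ℕ) :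
    ((Fin n → A) →ₗ[A] A) ≃ₗ[Aᵐᵒᵖ] (Fin n → Aᵐᵒᵖ) where
  toFun φ i := MulOpposite.op (φ (Pi.single i 1))
  map_add' _ _ := rfl
  map_smul' _ _ := rfl
  invFun v := Fintype.linearCombination A fun i => (v i).unop
  left_inv φ := by
    ext i
    simp
  right_inv v := by
    ext i
    simp

instance (n : ℕ) : Module.Projective Aᵐᵒᵖ ((Fin n → A) →ₗ[A] A) :=
  .of_equiv (dualPiEquiv A n).symm

instance (n : ℕ) : Module.Finite Aᵐᵒᵖ ((Fin n → A) →ₗ[A] A) :=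
  .equiv (dualPiEquiv A n).symm

lemma evalSurjective_pi (n : ℕ) : EvalSurjective A (Fin n → A) := by
  intro ψ
  refine ⟨fun i => ψ (LinearMap.proj i), fun φ => ?_⟩
  have hφ : φ = ∑ i, MulOpposite.op (φ (Pi.single i 1)) • LinearMap.proj i := by
    ext i
    simp [Pi.single_apply]
  conv_lhs => rw [hφ]
  rw [map_sum, LinearMap.pi_apply_eq_sum_univ φ]
  refine Finset.sum_congr rfl fun i _ => ?_
  rw [map_smul]
  have : (fun j => if i = j then (1 : A) else 0) = Pi.single i 1 := by
    ext j; simp [Pi.single_apply, eq_comm]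
  rw [this]
  simp

variable {M : Type u} [AddCommGroup M] [Module A M]

namespace FreeResolution

variable (F : FreeResolution A M)

lemma dualMap_aug_injective : Injective (dualMap F.aug) := fun _ _ h =>
  (LinearMap.cancel_right F.aug_surjective).1 h

lemma exact_dualMap_aug : Function.Exact (dualMap F.aug) (dualMap (F.d 0)).rangeRestrict := by
  intro φ
  rw [← Subtype.val_inj]
  constructor
  · intro h
    exact exists_comp_eq_of_ker_le F.aug_surjective φ fun x hx => by
      obtain ⟨y, rfl⟩ := (F.exact_aug x).1 hx
      exact LinearMap.congr_fun h y
  · rintro ⟨ψ, rfl⟩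
    refine LinearMap.ext fun x => ?_
    exact (congrArg ψ (F.exact_aug.apply_apply_eq_zero x)).trans (map_zero ψ)

lemma exact_subtype_mkQ : Function.Exact (LinearMap.range (dualMap (F.d 0))).subtype
    (LinearMap.range (dualMap (F.d 0))).mkQ := fun x => by simp

lemma extZero_transpose_zero_iff :
    ExtZero Aᵐᵒᵖ F.transpose A 0 ↔ IsTorsionless A M := by
  rw [extZero_zero_iff_extends (Submodule.injective_subtype _) F.exact_subtype_mkQ
    (Submodule.mkQ_surjective _) (.of_projective 0)]
  constructor
  · intro h m hm
    obtain ⟨x, rfl⟩ := F.aug_surjective m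
    have hker : ∀ φ, (dualMap (F.d 0)).rangeRestrict φ = 0 → evalAt (A := A) x φ = 0 := by
      intro φ hφ
      obtain ⟨f, rfl⟩ := (F.exact_dualMap_aug φ).1 hφ
      exact hm f
    obtain ⟨ψ, hψ⟩ := exists_comp_eq_of_ker_le (R := Aᵐᵒᵖ) (N := A)
      (G := (Fin (F.rank 0) → A) →ₗ[A] A) (M := LinearMap.range (dualMap (F.d 0)))
      (g := (dualMap (F.d 0)).rangeRestrict)
      (LinearMap.surjective_rangeRestrict _) (evalAt x) hker
    obtain ⟨χ, rfl⟩ := h ψ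
    obtain ⟨y, hy⟩ := evalSurjective_pi _ χ
    have hxy : x = F.d 0 y := by
      ext i
      exact (LinearMap.congr_fun hψ (LinearMap.proj i)).symm.trans (hy _)
    rw [hxy]
    exact F.exact_aug.apply_apply_eq_zero y
  · intro h ψ
    obtain ⟨x, hx⟩ := evalSurjective_pi _ (ψ.comp (dualMap (F.d 0)).rangeRestrict)
    obtain ⟨y, rfl⟩ := (F.exact_aug x).1 (h _ fun f => by
      refine (hx (dualMap F.aug f)).symm.trans ?_
      rw [LinearMap.comp_apply, F.exact_dualMap_aug.apply_apply_eq_zero, map_zero])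
    refine ⟨evalAt y, ?_⟩
    refine LinearMap.ext ?_
    rintro ⟨_, φ, rfl⟩
    exact (hx φ).symm

lemma extZero_transpose_one_iff :
    ExtZero Aᵐᵒᵖ F.transpose A 1 ↔ EvalSurjective A M := by
  rw [extZero_succ_iff (Submodule.injective_subtype _) F.exact_subtype_mkQ
    (Submodule.mkQ_surjective _) fun n => .of_projective n,
    extZero_zero_iff_extends F.dualMap_aug_injective F.exact_dualMap_aug
    (LinearMap.surjective_rangeRestrict _) (.of_projective 0)]
  constructor
  · intro h ψ
    obtain ⟨χ, rfl⟩ := h ψ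
    obtain ⟨x, hx⟩ := evalSurjective_pi _ χ
    exact ⟨F.aug x, fun φ => hx _⟩
  · intro h ψ
    obtain ⟨m, hm⟩ := h ψ
    obtain ⟨x, rfl⟩ := F.aug_surjective m
    exact ⟨evalAt x, LinearMap.ext fun φ => (hm φ).symm⟩

lemma extZero_transpose_add_two_iff (n : ℕ) :
    ExtZero Aᵐᵒᵖ F.transpose A (n + 2) ↔ ExtZero Aᵐᵒᵖ (M →ₗ[A] A) A n := by
  rw [extZero_succ_iff (Submodule.injective_subtype _) F.exact_subtype_mkQ
    (Submodule.mkQ_surjective _) fun n => .of_projective n,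
    extZero_succ_iff F.dualMap_aug_injective F.exact_dualMap_aug
    (LinearMap.surjective_rangeRestrict _) fun n => .of_projective n]

end FreeResolution

/-- A finitely generated module `M` is totally reflexive if and only if it is reflexive and
`Ext^i(M, A) = 0 = Ext^i(M*, A)` for all `i ≥ 1`. -/
lemma isTotallyReflexive_iff [IsNoetherianRing A] [IsNoetherianRing Aᵐᵒᵖ] [Module.Finite A M] :
    IsTotallyReflexive A M ↔ (∀ n, ExtZero A M A n) ∧ IsTorsionless A M ∧ EvalSurjective A M ∧
      ∀ n, ExtZero Aᵐᵒᵖ (M →ₗ[A] A) A n := by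
  simp only [IsTotallyReflexive, IsMNTorsionFree, le_top, forall_const, extVanish_iff_extZero]
  refine and_congr_right fun _ => ⟨fun h => ?_, fun ⟨h₀, h₁, h₂⟩ F j => ?_⟩
  · obtain ⟨F⟩ := FreeResolution.nonempty_of_finite (A := A) (M := M)
    exact ⟨F.extZero_transpose_zero_iff.1 (h F 0), F.extZero_transpose_one_iff.1 (h F 1),
      fun n => (F.extZero_transpose_add_two_iff n).1 (h F (n + 2))⟩
  · match j with
    | 0 => exact F.extZero_transpose_zero_iff.2 h₀
    | 1 => exact F.extZero_transpose_one_iff.2 h₁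
    | n + 2 => exact (F.extZero_transpose_add_two_iff n).2 (h₂ n)

lemma IsTotallyReflexive.of_equiv {N : Type u} [AddCommGroup N] [Module A N]
    (h : IsTotallyReflexive A N) (e : M ≃ₗ[A] N) : IsTotallyReflexive A M :=
  ⟨fun j hj F => h.1 j hj (F.ofEquiv e), fun F j hj => h.2 (F.ofEquiv e) j hj⟩

end Dual

namespace ZSeq

variable {A : Type u} [Ring A] {S : ZSeq A}

/-- The sequence `⋯ → M → M → M → ⋯` with maps alternately `0` and the identity. -/
def alternating (A : Type u) [Ring A] (M : Type u) [AddCommGroup M] [Module A M] : ZSeq A where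
  P _ := M
  d i := if Even i then 0 else LinearMap.id

lemma exact_subtype_rangeRestrict (hS : ∀ i : ℤ, Function.Exact (S.d (i + 1)) (S.d i)) (i : ℤ) :
    Function.Exact (LinearMap.range (S.d (i + 1))).subtype (S.d i).rangeRestrict := fun x => by
  rw [← Subtype.val_inj]
  simpa using hS i x

/-- If the dual sequence is exact, functionals on the images extend to the ambient modules. -/
lemma exists_extends
    (hS : ∀ i : ℤ, Function.Exact (S.d (i + 1)) (S.d i))
    (hdual : ∀ i : ℤ, Function.Exact (fun φ : S.P i →ₗ[A] A => φ.comp (S.d i))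
      (fun φ : S.P (i + 1) →ₗ[A] A => φ.comp (S.d (i + 1))))
    (i : ℤ) (φ : LinearMap.range (S.d i) →ₗ[A] A) :
    ∃ ψ : S.P i →ₗ[A] A, ψ.comp (LinearMap.range (S.d i)).subtype = φ := by
  obtain ⟨ψ, hψ⟩ := (hdual i (φ.comp (S.d i).rangeRestrict)).1 (by
    refine LinearMap.ext fun x => ?_
    have : (S.d i).rangeRestrict (S.d (i + 1) x) = 0 :=
      Subtype.ext ((hS i).apply_apply_eq_zero x)
    simp [this])
  refine ⟨ψ, LinearMap.ext ?_⟩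
  rintro ⟨_, x, rfl⟩
  exact LinearMap.congr_fun hψ x

lemma evalSurjective_range
    (hS : ∀ i : ℤ, Function.Exact (S.d (i + 1)) (S.d i))
    (hdual : ∀ i : ℤ, Function.Exact (fun φ : S.P i →ₗ[A] A => φ.comp (S.d i))
      (fun φ : S.P (i + 1) →ₗ[A] A => φ.comp (S.d (i + 1))))
    (hinj : ∀ i, IsTorsionless A (S.P i)) (hsurj : ∀ i, EvalSurjective A (S.P i)) (i : ℤ) :
    EvalSurjective A (LinearMap.range (S.d i)) := by
  obtain ⟨i, rfl⟩ : ∃ k, i = k + 1 := ⟨i - 1, by ring⟩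
  intro ψ
  obtain ⟨x, hx⟩ := hsurj _ (ψ.comp (dualMap (LinearMap.range (S.d (i + 1))).subtype))
  have hx0 : S.d i x = 0 := hinj i _ fun f => by
    refine (hx (f.comp (S.d i))).symm.trans ?_
    have : dualMap (LinearMap.range (S.d (i + 1))).subtype (f.comp (S.d i)) = 0 := by
      refine LinearMap.ext ?_
      rintro ⟨_, y, rfl⟩
      exact (congrArg f ((hS i).apply_apply_eq_zero y)).trans (map_zero f)
    rw [LinearMap.comp_apply, this, map_zero]
  refine ⟨⟨x, (hS i x).1 hx0⟩, fun φ => ?_⟩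
  obtain ⟨φ, rfl⟩ := exists_extends hS hdual _ φ
  exact hx φ

lemma isTotallyReflexive_range [IsNoetherianRing A] [IsNoetherianRing Aᵐᵒᵖ]
    (hG : ∀ i : ℤ, Module.Finite A (S.P i) ∧ IsTotallyReflexive A (S.P i))
    (hS : ∀ i : ℤ, Function.Exact (S.d (i + 1)) (S.d i))
    (hdual : ∀ i : ℤ, Function.Exact (fun φ : S.P i →ₗ[A] A => φ.comp (S.d i))
      (fun φ : S.P (i + 1) →ₗ[A] A => φ.comp (S.d (i + 1))))
    (i : ℤ) : IsTotallyReflexive A (LinearMap.range (S.d i)) := by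
  have hfin (i : ℤ) : Module.Finite A (S.P i) := (hG i).1
  have hTR (i : ℤ) := isTotallyReflexive_iff.1 (hG i).2
  have hext := exists_extends hS hdual
  have heval := evalSurjective_range hS hdual (fun i => (hTR i).2.1) fun i => (hTR i).2.2.1
  refine isTotallyReflexive_iff.2 ⟨fun n => ?_, fun x hx => ?_, heval i, fun n => ?_⟩
  · refine extZero_of_forall_shortExact (fun i => LinearMap.range (S.d i)) (fun i => ?_) n i
    exact ⟨i + 1, S.P (i + 1), inferInstance, inferInstance, _, _,
      Submodule.injective_subtype _, exact_subtype_rangeRestrict hS i,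
      LinearMap.surjective_rangeRestrict _, (hTR _).1, hext (i + 1)⟩
  · exact Subtype.ext ((hTR i).2.1 x fun φ => hx (φ.comp (Submodule.subtype _)))
  · refine extZero_of_forall_shortExact (fun i => LinearMap.range (S.d i) →ₗ[A] A) (fun i => ?_) n i
    obtain ⟨i, rfl⟩ : ∃ k, i = k + 1 := ⟨i - 1, by ring⟩
    refine ⟨i, S.P (i + 1) →ₗ[A] A, inferInstance, inferInstance, dualMap (S.d i).rangeRestrict,
      dualMap (LinearMap.range (S.d (i + 1))).subtype, fun _ _ h =>
      (LinearMap.cancel_right (LinearMap.surjective_rangeRestrict _)).1 h,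
      fun φ => ⟨fun h => ?_, ?_⟩,
      hext (i + 1), (hTR _).2.2.2, fun ψ => ?_⟩
    · refine exists_comp_eq_of_ker_le (LinearMap.surjective_rangeRestrict _) φ fun x hx => ?_
      obtain ⟨y, rfl⟩ := (exact_subtype_rangeRestrict hS i x).1 hx
      exact LinearMap.congr_fun h y
    · rintro ⟨ψ, rfl⟩
      refine LinearMap.ext fun x => ?_
      exact (congrArg ψ ((exact_subtype_rangeRestrict hS i).apply_apply_eq_zero x)).trans
        (map_zero ψ)
    · obtain ⟨⟨_, x, rfl⟩, hx⟩ := heval i ψ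
      exact ⟨evalAt x, LinearMap.ext fun φ => (hx φ).symm⟩

end ZSeq

/-- **Corollary 1.2(1) / 2.3 (Araya–Takahashi; cf. Sather-Wagstaff–Sharif–White).**
Let `Λ` be a left and right noetherian ring.  A finitely generated `Λ`-module `M`
is totally reflexive if and only if there exists an exact sequence
`⋯ → G_1 → G_0 →∂ G_{-1} → G_{-2} → ⋯`, unbounded in both directions, of finitely
generated totally reflexive `Λ`-modules, whose `Λ`-dual is also exact and such
that the image of `∂ = S.d (-1) : G_0 → G_{-1}` is isomorphic to `M`. -/
theorem isTotallyReflexive_iff_exists_complete_sequence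
    (A : Type u) [Ring A] [IsNoetherianRing A] [IsNoetherianRing Aᵐᵒᵖ]
    (M : Type u) [AddCommGroup M] [Module A M] [Module.Finite A M] :
    IsTotallyReflexive A M ↔
      ∃ S : ZSeq A,
        (∀ i : ℤ, Module.Finite A (S.P i) ∧ IsTotallyReflexive A (S.P i)) ∧
        (∀ i : ℤ, Function.Exact (S.d (i + 1)) (S.d i)) ∧
        (∀ i : ℤ, Function.Exact (fun φ : S.P i →ₗ[A] A => φ.comp (S.d i))
          (fun φ : S.P (i + 1) →ₗ[A] A => φ.comp (S.d (i + 1)))) ∧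
        Nonempty (M ≃ₗ[A] ↥(LinearMap.range (S.d (-1)))) := by
  constructor
  · intro h
    refine ⟨ZSeq.alternating A M, fun i => ⟨‹_›, h⟩, fun i => ?_, fun i => ?_, ⟨?_⟩⟩
    · change Function.Exact (if Even (i + 1) then (0 : M →ₗ[A] M) else LinearMap.id : M →ₗ[A] M)
        (if Even i then (0 : M →ₗ[A] M) else LinearMap.id : M →ₗ[A] M)
      intro x
      rcases Int.even_or_odd i with hi | hi
      · have hparity : ¬ Odd i := Int.not_odd_iff_even.2 hi
        simp [hi, hparity]
      · have hparity : ¬ Even i := Int.not_even_iff_odd.2 hi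
        simp [hi, hparity, eq_comm]
    · change Function.Exact
        (fun φ : M →ₗ[A] A => φ.comp (if Even i then (0 : M →ₗ[A] M) else LinearMap.id))
        (fun φ : M →ₗ[A] A => φ.comp (if Even (i + 1) then (0 : M →ₗ[A] M) else LinearMap.id))
      intro φ
      rcases Int.even_or_odd i with hi | hi
      · have hparity : ¬ Odd i := Int.not_odd_iff_even.2 hi
        simp [hi, hparity, eq_comm (a := φ)]
      · have hparity : ¬ Even i := Int.not_even_iff_odd.2 hi
        simp [hi, hparity]
    · have hd : (ZSeq.alternating A M).d (-1) = (LinearMap.id : M →ₗ[A] M) := by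
        change (if Even (-1 : ℤ) then (0 : M →ₗ[A] M) else LinearMap.id) = LinearMap.id
        exact if_neg (by decide)
      rw [hd]
      exact (LinearEquiv.ofTop (LinearMap.range (LinearMap.id : M →ₗ[A] M))
        LinearMap.range_id).symm
  · rintro ⟨S, hG, hS, hdual, ⟨e⟩⟩
    exact (ZSeq.isTotallyReflexive_range hG hS hdual (-1)).of_equiv e
end
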